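/- arXiv:2004.09935 — 3 statements merged into one kernel-verified Lean document; each statement's English description precedes it below -/
import Mathlib

section
/- For every C > 0 and δ > 0 there exist ε > 0 and N₀ such that for all N ≥ N₀, all q ≤ εN, all nonnegative integers s_1,…,s_q with s_i ≤ C·N for all i ∈ [q] (and satisfying s_1 ≤ ⌈log₂ N⌉ and s_{i+1} ≤ s_i + ⌈log₂ N⌉), and every (s_1,…,s_q)-memory-bounded streaming algorithm A, it holds that D_KL(P_A‖Q_A) ≤ (1+δ) · (Σ_{i=1}^{q−1} s_i + q·log₂ N)/(N·log₂(N/q)). -/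
open scoped Classical

/-- The sequence of internal states of a streaming algorithm `A` processing the
input `x = (x_1, …, x_q) ∈ [N]^q`: the state `σ_0` is the empty string, and
`σ_i = A(i, σ_{i-1}, x_i)` for `i = 1, …, q`. -/
def streamRun {N q : ℕ} (A : ℕ → List Bool → Fin N → List Bool)
    (x : Fin q → Fin N) : ℕ → List Bool
  | 0 => []
  | (i + 1) =>
      if h : i < q then A (i + 1) (streamRun A x i) (x ⟨i, h⟩) else streamRun A x i

/-- `A` is `(s_1, …, s_q)`-memory-bounded: on every input, the state after step `i`
is a bit string of length exactly `s_i`, for every `i ∈ [q]`. -/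
def MemoryBounded (N q : ℕ) (A : ℕ → List Bool → Fin N → List Bool) (s : ℕ → ℕ) : Prop :=
  ∀ x : Fin q → Fin N, ∀ i : ℕ, 1 ≤ i → i ≤ q → (streamRun A x i).length = s i

/-- `P`: the distribution of a sample of `q` values drawn uniformly without
replacement from `[N]` (the first `q` entries of a uniformly random permutation),
i.e. the uniform distribution over injective sequences. -/
noncomputable def Pdist (N q : ℕ) : (Fin q → Fin N) → ℝ := fun x =>
  if Function.Injective x then ((Nat.descFactorial N q : ℝ))⁻¹ else 0

/-- `Q`: the distribution of `q` i.i.d. uniform samples from `[N]`. -/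
noncomputable def Qdist (N q : ℕ) : (Fin q → Fin N) → ℝ := fun _ => ((N : ℝ) ^ q)⁻¹

/-- The distribution of the output `A(X) = σ_q` of the streaming algorithm `A`
when the input `X` is distributed according to `μ`. -/
noncomputable def outDist {N q : ℕ} (A : ℕ → List Bool → Fin N → List Bool)
    (μ : (Fin q → Fin N) → ℝ) : List Bool → ℝ := fun σ =>
  ∑ x : Fin q → Fin N, if streamRun A x q = σ then μ x else 0

/-- Kullback–Leibler divergence (natural logarithm). -/
noncomputable def klDiv {α : Type*} (p q : α → ℝ) : ℝ :=
  ∑' a, p a * Real.log (p a / q a)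


/-- mode of binomial -/
lemma mode_up (N i : ℕ) (hi : i ≤ N) (k : ℕ) (hk : k < i) :
    N.choose k * i ^ k * (N - i) ^ (N - k) ≤ N.choose (k+1) * i ^ (k+1) * (N - i) ^ (N - (k+1)) := by
  have h1 : N - k = (N - (k+1)) + 1 := by omega
  rw [h1, pow_succ, pow_succ]
  have h2 := Nat.choose_succ_right_eq N k
  have h3 : (k+1) * (N - i) ≤ (N - k) * i := by
    obtain ⟨d, rfl⟩ := Nat.exists_eq_add_of_le hi
    obtain ⟨e, rfl⟩ := Nat.exists_eq_add_of_lt hk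
    have : k + e + 1 + d - k = e + 1 + d := by omega
    rw [this]; simp only [Nat.add_sub_cancel_left]; nlinarith [Nat.zero_le (k*e), Nat.zero_le (e*e), Nat.zero_le (e*d)]
  have h4 : N.choose k * (N - i) ≤ N.choose (k+1) * i := by
    have : (k+1) * (N.choose k * (N - i)) ≤ (k+1) * (N.choose (k+1) * i) := by
      calc (k+1) * (N.choose k * (N - i)) = N.choose k * ((k+1) * (N - i)) := by ring
        _ ≤ N.choose k * ((N-k) * i) := Nat.mul_le_mul_left _ h3
        _ = (N.choose k * (N-k)) * i := by ring
        _ = _ := by rw [← h2]; ring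
    exact Nat.le_of_mul_le_mul_left this (by omega)
  calc _ = (N.choose k * (N - i)) * (i^k * (N-i)^(N-(k+1))) := by ring
    _ ≤ (N.choose (k+1) * i) * (i^k * (N-i)^(N-(k+1))) := Nat.mul_le_mul_right _ h4
    _ = _ := by ring

lemma mode_down (N i : ℕ) (k : ℕ) (hk : i ≤ k) (hkN : k < N) :
    N.choose (k+1) * i ^ (k+1) * (N - i) ^ (N - (k+1)) ≤ N.choose k * i ^ k * (N - i) ^ (N - k) := by
  have h1 : N - k = (N - (k+1)) + 1 := by omega
  rw [h1, pow_succ, pow_succ]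
  have h2 := Nat.choose_succ_right_eq N k
  have h3 : (N - k) * i ≤ (k+1) * (N - i) := by
    obtain ⟨d, rfl⟩ := Nat.exists_eq_add_of_lt hkN
    obtain ⟨e, rfl⟩ := Nat.exists_eq_add_of_le hk
    have : i + e + d + 1 - (i+e) = d + 1 := by omega
    have h' : i + e + d + 1 - i = e + d + 1 := by omega
    rw [this, h']; nlinarith [Nat.zero_le (i*e), Nat.zero_le (e*e), Nat.zero_le (e*d)]
  have h4 : N.choose (k+1) * i ≤ N.choose k * (N - i) := by
    have : (k+1) * (N.choose (k+1) * i) ≤ (k+1) * (N.choose k * (N - i)) := by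
      calc (k+1) * (N.choose (k+1) * i) = (N.choose (k+1) * (k+1)) * i := by ring
        _ = N.choose k * ((N-k) * i) := by rw [h2]; ring
        _ ≤ N.choose k * ((k+1) * (N-i)) := Nat.mul_le_mul_left _ h3
        _ = _ := by ring
    exact Nat.le_of_mul_le_mul_left this (by omega)
  calc _ = (N.choose (k+1) * i) * (i^k * (N-i)^(N-(k+1))) := by ring
    _ ≤ (N.choose k * (N - i)) * (i^k * (N-i)^(N-(k+1))) := Nat.mul_le_mul_right _ h4
    _ = _ := by ring

lemma mode_le (N i : ℕ) (hi : i ≤ N) (k : ℕ) (hk : k ≤ N) :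
    N.choose k * i ^ k * (N - i) ^ (N - k) ≤ N.choose i * i ^ i * (N - i) ^ (N - i) := by
  rcases le_total k i with h | h
  · have : ∀ d, d ≤ i → N.choose (i-d) * i ^ (i-d) * (N - i) ^ (N - (i-d)) ≤ N.choose i * i ^ i * (N - i) ^ (N - i) := by
      intro d
      induction d with
      | zero => intro _; simp
      | succ d ih =>
        intro hd
        have h1 := mode_up N i hi (i - (d+1)) (by omega)
        have h2 : i - (d+1) + 1 = i - d := by omega
        rw [h2] at h1
        exact h1.trans (ih (by omega))
    have := this (i-k) (by omega)
    rwa [show i - (i-k) = k by omega] at this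
  · induction k, h using Nat.le_induction with
    | base => exact le_refl _
    | succ k hik ih =>
      exact (mode_down N i k hik (by omega)).trans (ih (by omega))

lemma mode_bound (N i : ℕ) (hi : i ≤ N) :
    N ^ N ≤ (N + 1) * (N.choose i * i ^ i * (N - i) ^ (N - i)) := by
  have h := add_pow i (N - i) N
  rw [show i + (N - i) = N by omega] at h
  rw [h]
  calc _ ≤ ∑ m ∈ Finset.range (N+1), (N.choose i * i ^ i * (N - i) ^ (N - i)) := by
        apply Finset.sum_le_sum
        intro m hm
        have := mode_le N i hi m (by simpa [Nat.lt_succ_iff] using hm)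
        calc _ = N.choose m * i ^ m * (N - i) ^ (N - m) := by push_cast; ring
          _ ≤ _ := this
    _ = _ := by simp

/-- analytic -/
lemma kx (x : ℝ) (hx : 0 ≤ x) : (x-1)^2 / (2*(x+1)) ≤ x * Real.log x - x + 1 := by
  rcases hx.eq_or_lt with rfl | hx
  · norm_num
  set r := Real.sqrt x with hr
  have hr0 : 0 < r := Real.sqrt_pos.mpr hx
  have hxr : x = r^2 := (Real.sq_sqrt hx.le).symm
  have h1 : 1 - r⁻¹ ≤ Real.log r := Real.one_sub_inv_le_log_of_pos hr0
  rw [hxr, Real.log_pow]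
  have h2 : r^2 * (2*(1 - r⁻¹)) ≤ r^2 * (2 * Real.log r) := by gcongr
  have h3 : r^2 * (2*(1 - r⁻¹)) = 2*r^2 - 2*r := by field_simp
  have h4 : (r^2-1)^2 / (2*(r^2+1)) ≤ (r-1)^2 := by
    rw [div_le_iff₀ (by positivity)]
    have : (r^2-1)^2 = (r-1)^2*(r+1)^2 := by ring
    rw [this]
    apply mul_le_mul_of_nonneg_left _ (sq_nonneg _)
    nlinarith [sq_nonneg (r-1)]
  push_cast
  nlinarith

open Filter Topology in
lemma analytic (δ : ℝ) (hδ : 0 < δ) : ∃ ε > (0:ℝ), ε ≤ 1/2 ∧ ∀ a : ℝ, 0 < a → a ≤ ε → ∀ p : ℝ, 0 ≤ p → p ≤ 1 →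
    (p - a)^2/(1-a)^2 * Real.log (1/a) ≤ (1+δ) * (p * Real.log (p/a) - p + a) := by
  -- δ' with (1+δ')^2 ≤ 1+δ, (1-a)^{-2} ≤ 1+δ'
  obtain ⟨e, he, he1⟩ : ∃ e > (0:ℝ), (1+e)^2 ≤ 1+δ := by
    refine ⟨min 1 (δ/3), by positivity, ?_⟩
    have h1 := min_le_left 1 (δ/3)
    have h2 := min_le_right 1 (δ/3)
    have h3 : 0 < min 1 (δ/3) := by positivity
    nlinarith
  set K := Real.exp (1 + 1/e) with hK
  have hK1 : Real.exp 1 ≤ K := Real.exp_le_exp.mpr (by have : 0 < 1/e := by positivity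
                                                       linarith)
  have hKpos : 0 < K := Real.exp_pos _
  have hlim : Tendsto (fun a : ℝ => a * Real.log (1/a)) (𝓝[>] 0) (𝓝 0) := by
    have h := Real.continuous_mul_log.tendsto 0
    simp only [zero_mul] at h
    have h2 := (h.neg).mono_left (nhdsWithin_le_nhds (s := Set.Ioi (0:ℝ)))
    simpa [Real.log_inv] using h2
  have hlim2 : Tendsto (fun a : ℝ => ((1-a)^2)⁻¹) (𝓝[>] 0) (𝓝 1) := by
    have : ContinuousAt (fun a : ℝ => ((1-a)^2)⁻¹) 0 := by
      apply ContinuousAt.inv₀ (by fun_prop) (by norm_num)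
    have h := this.tendsto
    simp only [sub_zero, one_pow, inv_one] at h
    exact h.mono_left nhdsWithin_le_nhds
  have ev1 := hlim.eventually (gt_mem_nhds (show (0:ℝ) < 1/(2*(K+1)) by positivity))
  have ev2 := hlim2.eventually (gt_mem_nhds (show (1:ℝ) < 1+e by linarith))
  obtain ⟨u, hu, hu2⟩ := mem_nhdsGT_iff_exists_Ioc_subset.mp (ev1.and ev2)
  have hu0 : 0 < u := hu
  refine ⟨min u (1/2), by positivity, min_le_right _ _, ?_⟩
  intro a ha hale p hp0 hp1
  obtain ⟨h1, h2⟩ := hu2 ⟨ha, hale.trans (min_le_left _ _)⟩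
  have hahalf : a ≤ 1/2 := hale.trans (min_le_right _ _)
  set L := Real.log (1/a) with hL
  have hL0 : 0 < L := Real.log_pos (by rw [lt_div_iff₀ ha]; linarith)
  set x := p/a with hx
  have hx0 : 0 ≤ x := by positivity
  have hpx : p = a * x := by rw [hx]; field_simp
  have hxa : x ≤ 1/a := by rw [hx]; gcongr
  have hk := kx x hx0
  set k := x * Real.log x - x + 1 with hkdef
  have hk0 : 0 ≤ k := le_trans (by positivity) hk
  have hrhs : p * Real.log x - p + a = a * k := by rw [hpx, hkdef]; ring
  have hlhs : (p - a)^2/(1-a)^2 * L = a * ((a * L) * (x-1)^2 * ((1-a)^2)⁻¹) := by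
    rw [hpx]; field_simp
  rw [hrhs, hlhs]
  suffices h : (a*L) * (x-1)^2 ≤ (1+e) * k by
    have : (a * L) * (x-1)^2 * ((1-a)^2)⁻¹ ≤ (1+e)*k * (1+e) :=
      mul_le_mul h h2.le (by positivity) (by positivity)
    calc a * ((a * L) * (x-1)^2 * ((1-a)^2)⁻¹) ≤ a * ((1+e)*k * (1+e)) := by gcongr
      _ = (1+e)^2 * (a*k) := by ring
      _ ≤ _ := by gcongr
  rcases le_total x K with hxK | hxK
  · calc (a*L) * (x-1)^2 ≤ 1/(2*(K+1)) * (x-1)^2 := by gcongr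
      _ ≤ 1/(2*(x+1)) * (x-1)^2 := by gcongr
      _ = (x-1)^2/(2*(x+1)) := by ring
      _ ≤ k := hk
      _ ≤ (1+e)*k := by nlinarith
  · have hxe : Real.exp 1 ≤ x := hK1.trans hxK
    have hxpos : 0 < x := hKpos.trans_le hxK
    have hx1 : 1 ≤ x := (Real.one_le_exp (by norm_num)).trans hxe
    have h5 := Real.log_div_self_antitoneOn (show x ∈ {x | Real.exp 1 ≤ x} from hxe) (show (1/a) ∈ {x | Real.exp 1 ≤ x} from hxe.trans hxa) hxa
    have h6 : a * L ≤ Real.log x / x := by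
      calc a * L = Real.log (1/a) / (1/a) := by rw [hL]; field_simp
        _ ≤ _ := h5
    have h7 : 1 + 1/e ≤ Real.log x := by
      rw [Real.le_log_iff_exp_le hxpos]; exact hxK
    have h8 : Real.log x ≤ (1+e) * (Real.log x - 1) := by
      have : e * (1+1/e) ≤ e * Real.log x := by gcongr
      have h9 : e * (1+1/e) = e + 1 := by field_simp
      nlinarith
    calc (a*L) * (x-1)^2 ≤ (Real.log x / x) * (x-1)^2 := by gcongr
      _ ≤ (Real.log x / x) * x^2 := by
          apply mul_le_mul_of_nonneg_left _ (by have := Real.log_nonneg hx1; positivity)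
          nlinarith
      _ = x * Real.log x := by field_simp
      _ ≤ x * ((1+e) * (Real.log x - 1)) := by gcongr
      _ = (1+e) * (k - 1) := by rw [hkdef]; ring
      _ ≤ _ := by nlinarith

lemma fiber_card (N n : ℕ) (S : Finset (Fin N)) (hS : S.card = n) :
    ((Finset.univ : Finset (Fin n → Fin N)).filter
      (fun x => Function.Injective x ∧ Finset.univ.image x = S)).card ≤ n.factorial := by
  have h : Fintype.card (Fin n ↪ S) = n.factorial := by
    rw [Fintype.card_embedding_eq]; simp [hS, Nat.descFactorial_self]
  rw [← h, ← Finset.card_univ]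
  have hinj : Function.Injective (fun (f : Fin n ↪ S) (t : Fin n) => ((f t : S) : Fin N)) := by
    intro f g hfg
    ext t
    have := congrFun hfg t
    simpa using congrArg Fin.val this
  rw [← Finset.card_image_of_injective Finset.univ hinj]
  apply Finset.card_le_card
  intro x hx
  simp only [Finset.mem_filter, Finset.mem_univ, true_and] at hx
  obtain ⟨hx1, hx2⟩ := hx
  rw [Finset.mem_image]
  have hm : ∀ t, x t ∈ S := fun t => by rw [← hx2]; exact Finset.mem_image_of_mem _ (Finset.mem_univ _)
  exact ⟨⟨fun t => ⟨x t, hm t⟩, fun a b hab => hx1 (by simpa using hab)⟩, Finset.mem_univ _, rfl⟩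

lemma prod_le_pow (N : ℕ) (t : ℝ) (ht : 0 < t) (w : Fin N → ℝ) (hw : ∀ j, 0 ≤ w j)
    (hsum : ∑ j, w j ≤ N) : ∏ j, (1 + t * w j) ≤ (1+t)^N := by
  have h1 : ∀ j, 1 + t * w j ≤ (1+t) * Real.exp (t/(1+t) * (w j - 1)) := by
    intro j
    have := Real.add_one_le_exp (t/(1+t) * (w j - 1))
    calc 1 + t * w j = (1+t) * (t/(1+t) * (w j - 1) + 1) := by field_simp; ring
      _ ≤ _ := by gcongr
  calc ∏ j, (1 + t * w j) ≤ ∏ j, ((1+t) * Real.exp (t/(1+t) * (w j - 1))) := by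
        apply Finset.prod_le_prod
        · intro j _; have := hw j; positivity
        · intro j _; exact h1 j
    _ = (1+t)^N * Real.exp (t/(1+t) * (∑ j, w j - N)) := by
        rw [Finset.prod_mul_distrib, ← Real.exp_sum, ← Finset.mul_sum]; simp
    _ ≤ (1+t)^N * 1 := by
        gcongr
        rw [Real.exp_le_one_iff]
        apply mul_nonpos_of_nonneg_of_nonpos (by positivity); linarith
    _ = _ := mul_one _

lemma weakMac (N n : ℕ) (hn : 1 ≤ n) (hnN : n < N) (w : Fin N → ℝ) (hw : ∀ j, 0 ≤ w j)
    (hsum : ∑ j, w j ≤ N) :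
    ∑ x, Pdist N n x * ∏ t, w (x t) ≤ N + 1 := by
  set E := ∑ S ∈ (Finset.univ : Finset (Fin N)).powersetCard n, ∏ j ∈ S, w j with hE
  have hdesc : (0:ℝ) < N.descFactorial n := by
    exact_mod_cast Nat.descFactorial_pos.mpr hnN.le
  have h1 : ∑ x, Pdist N n x * ∏ t, w (x t) ≤ (N.descFactorial n : ℝ)⁻¹ * (n.factorial * E) := by
    have e1 : ∑ x, Pdist N n x * ∏ t, w (x t) = (N.descFactorial n : ℝ)⁻¹ *
        ∑ x ∈ (Finset.univ : Finset (Fin n → Fin N)).filter (fun x => Function.Injective x), ∏ t, w (x t) := by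
      rw [Finset.mul_sum, Finset.sum_filter]
      apply Finset.sum_congr rfl
      intro x _
      unfold Pdist
      split_ifs <;> simp
    rw [e1]
    apply mul_le_mul_of_nonneg_left _ (by positivity)
    rw [← Finset.sum_fiberwise_of_maps_to (t := (Finset.univ : Finset (Fin N)).powersetCard n)
      (g := fun x => Finset.univ.image x)]
    · rw [hE, Finset.mul_sum]
      apply Finset.sum_le_sum
      intro S hS
      have hS' : S.card = n := (Finset.mem_powersetCard.mp hS).2
      rw [Finset.filter_filter]
      calc _ = ∑ x ∈ (Finset.univ : Finset (Fin n → Fin N)).filter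
            (fun x => Function.Injective x ∧ Finset.univ.image x = S), ∏ j ∈ S, w j := by
            apply Finset.sum_congr rfl
            intro x hx
            obtain ⟨_, hx1, hx2⟩ := Finset.mem_filter.mp hx
            rw [← hx2, Finset.prod_image (fun a _ b _ h => hx1 h)]
        _ = _ * ∏ j ∈ S, w j := by rw [Finset.sum_const, nsmul_eq_mul]
        _ ≤ _ := by
            apply mul_le_mul_of_nonneg_right _ (Finset.prod_nonneg fun j _ => hw j)
            exact_mod_cast fiber_card N n S hS'
    · intro x hx
      obtain ⟨_, hx1⟩ := Finset.mem_filter.mp hx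
      rw [Finset.mem_powersetCard]
      refine ⟨Finset.subset_univ _, ?_⟩
      rw [Finset.card_image_of_injective _ hx1]; simp
  have hNn : (0:ℝ) < (N:ℝ) - n := by
    have : (n:ℝ) < N := by exact_mod_cast hnN
    linarith
  have hn0 : (0:ℝ) < n := by exact_mod_cast hn
  set t : ℝ := n / ((N:ℝ) - n) with ht
  have ht0 : 0 < t := by positivity
  have h2 : t^n * E ≤ (1+t)^N := by
    refine le_trans ?_ (prod_le_pow N t ht0 w hw hsum)
    rw [Finset.prod_one_add, hE, Finset.mul_sum]
    calc _ = ∑ S ∈ (Finset.univ : Finset (Fin N)).powersetCard n, ∏ j ∈ S, (t * w j) := by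
          apply Finset.sum_congr rfl
          intro S hS
          rw [Finset.prod_mul_distrib, Finset.prod_const, (Finset.mem_powersetCard.mp hS).2]
      _ ≤ _ := by
          apply Finset.sum_le_sum_of_subset_of_nonneg
          · intro S hS; simp
          · intro S _ _
            exact Finset.prod_nonneg fun j _ => mul_nonneg ht0.le (hw j)
  have h3 : (1+t)^N ≤ (N+1) * (N.choose n) * t^n := by
    have hm := mode_bound N n hnN.le
    have hm' : (N:ℝ)^N ≤ (N+1) * (N.choose n * n^n * ((N:ℝ)-n)^(N-n)) := by
      rw [← Nat.cast_sub hnN.le]; exact_mod_cast hm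
    have e1 : 1 + t = N / ((N:ℝ)-n) := by rw [ht]; field_simp; ring
    rw [e1, ht, div_pow, div_pow, div_le_iff₀ (by positivity)]
    refine hm'.trans (le_of_eq ?_)
    have : ((N:ℝ)-n)^N = ((N:ℝ)-n)^(N-n) * ((N:ℝ)-n)^n := by
      rw [← pow_add]; congr 1; omega
    rw [this]; field_simp
  have h4 : E ≤ (N+1) * N.choose n := by
    have : t^n * E ≤ t^n * ((N+1) * N.choose n) := by linarith
    exact le_of_mul_le_mul_left this (by positivity)
  refine h1.trans ?_
  rw [inv_mul_le_iff₀ hdesc, Nat.descFactorial_eq_factorial_mul_choose]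
  push_cast
  calc (n.factorial:ℝ) * E ≤ n.factorial * ((N+1) * N.choose n) := by gcongr
    _ = _ := by ring

lemma exp_push {X : Type*} [Fintype X] (r : X → List Bool) (μ : X → ℝ) (F : List Bool → ℝ) :
    ∑ σ ∈ Finset.univ.image r, (∑ x, if r x = σ then μ x else 0) * F σ = ∑ x, μ x * F (r x) := by
  simp_rw [Finset.sum_mul]
  rw [Finset.sum_comm]
  apply Finset.sum_congr rfl
  intro x _
  rw [Finset.sum_eq_single (r x)]
  · simp
  · intro b _ hb; simp [Ne.symm hb]
  · intro h; exact absurd (Finset.mem_image_of_mem _ (Finset.mem_univ x)) h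

lemma Pdist_nonneg (N n : ℕ) (x : Fin n → Fin N) : 0 ≤ Pdist N n x := by
  unfold Pdist; split_ifs <;> positivity

lemma Pdist_sum (N n : ℕ) (h : n ≤ N) : ∑ x, Pdist N n x = 1 := by
  unfold Pdist
  rw [← Finset.sum_filter, Finset.sum_const, nsmul_eq_mul]
  have hd : (0:ℝ) < N.descFactorial n := by
    exact_mod_cast Nat.descFactorial_pos.mpr h
  have : (Finset.univ.filter (fun x : Fin n → Fin N => Function.Injective x)).card = N.descFactorial n := by
    have h1 : Fintype.card (Fin n ↪ Fin N) = N.descFactorial n := by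
      rw [Fintype.card_embedding_eq]; simp
    rw [← h1, ← Fintype.card_subtype]
    exact Fintype.card_congr (Equiv.subtypeInjectiveEquivEmbedding _ _)
  rw [this]
  field_simp

noncomputable def pS {N n : ℕ} (r : (Fin n → Fin N) → List Bool) (σ : List Bool) : ℝ :=
  ∑ x, if r x = σ then Pdist N n x else 0

noncomputable def pW {N n : ℕ} (r : (Fin n → Fin N) → List Bool) (σ : List Bool) (y : Fin N) : ℝ :=
  ∑ x, if r x = σ then (if y ∈ Set.range x then Pdist N n x else 0) else 0

noncomputable def pp {N n : ℕ} (r : (Fin n → Fin N) → List Bool) (σ : List Bool) (y : Fin N) : ℝ :=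
  pW r σ y / pS r σ

section
variable {N n : ℕ} (r : (Fin n → Fin N) → List Bool)

lemma pS_nonneg (σ : List Bool) : 0 ≤ pS r σ := by
  apply Finset.sum_nonneg; intro x _
  have := Pdist_nonneg N n x
  split_ifs <;> simp [this]

lemma pW_nonneg (σ : List Bool) (y : Fin N) : 0 ≤ pW r σ y := by
  apply Finset.sum_nonneg; intro x _
  have := Pdist_nonneg N n x
  split_ifs <;> simp [this]

lemma pW_le (σ : List Bool) (y : Fin N) : pW r σ y ≤ pS r σ := by
  apply Finset.sum_le_sum; intro x _
  have := Pdist_nonneg N n x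
  split_ifs <;> simp [this]

lemma pp_nonneg (σ : List Bool) (y : Fin N) : 0 ≤ pp r σ y :=
  div_nonneg (pW_nonneg r σ y) (pS_nonneg r σ)

lemma pp_le_one (σ : List Bool) (y : Fin N) : pp r σ y ≤ 1 :=
  div_le_one_of_le₀ (pW_le r σ y) (pS_nonneg r σ)

lemma pS_mul_pp (σ : List Bool) (y : Fin N) : pS r σ * pp r σ y = pW r σ y := by
  unfold pp
  by_cases h : pS r σ = 0
  · have h1 := pW_le r σ y
    have h2 := pW_nonneg r σ y
    rw [h] at h1 ⊢
    simp; linarith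
  · field_simp

lemma sum_range_ite (x : Fin n → Fin N) (F : Fin N → ℝ) :
    Pdist N n x * ∑ t, F (x t) = ∑ y, (if y ∈ Set.range x then Pdist N n x else 0) * F y := by
  by_cases hx : Function.Injective x
  · have h1 : ∑ t, F (x t) = ∑ y ∈ Finset.univ.image x, F y := by
      rw [Finset.sum_image (fun a _ b _ h => hx h)]
    rw [h1, Finset.mul_sum]
    have h2 : Finset.univ.image x = Finset.univ.filter (fun y => y ∈ Set.range x) := by
      ext y; simp
    rw [h2, Finset.sum_filter]
    apply Finset.sum_congr rfl
    intro y _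
    split_ifs <;> simp
  · have : Pdist N n x = 0 := by unfold Pdist; simp [hx]
    simp [this]

lemma sum_pW (σ : List Bool) : ∑ y, pW r σ y = n * pS r σ := by
  unfold pW pS
  rw [Finset.sum_comm, Finset.mul_sum]
  apply Finset.sum_congr rfl
  intro x _
  have := sum_range_ite x (fun _ => 1)
  simp only [Finset.sum_const, Finset.card_univ, Fintype.card_fin, nsmul_eq_mul, mul_one] at this
  by_cases h : r x = σ
  · simp only [h, if_true]
    rw [← this]; ring
  · simp [h]

lemma sum_pp (σ : List Bool) (h : pS r σ ≠ 0) : ∑ y, pp r σ y = n := by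
  unfold pp
  rw [← Finset.sum_div, sum_pW]
  field_simp

lemma sum_pp_le (σ : List Bool) : ∑ y, pp r σ y ≤ n := by
  by_cases h : pS r σ = 0
  · simp [pp, h]
  · exact (sum_pp r σ h).le

lemma info (hn : 1 ≤ n) (hnN : n < N) :
    ∑ σ ∈ Finset.univ.image r, pS r σ * ∑ y, pp r σ y * Real.log (pp r σ y / ((n:ℝ)/N)) ≤
      Real.log ((Finset.univ.image r).card) + Real.log (N+1) := by
  set T := Finset.univ.image r with hT
  set a : ℝ := (n:ℝ)/N with ha
  have hn0 : (0:ℝ) < n := by exact_mod_cast hn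
  have hN0 : (0:ℝ) < N := by exact_mod_cast (by omega : 0 < N)
  have ha0 : 0 < a := by positivity
  have : Nonempty (Fin N) := ⟨⟨0, by omega⟩⟩
  have hTc : (0:ℝ) < T.card := by
    have : 0 < T.card := Finset.card_pos.mpr (Finset.Nonempty.image Finset.univ_nonempty r)
    exact_mod_cast this
  set w : List Bool → Fin N → ℝ := fun σ y => pp r σ y / a with hw
  have hw0 : ∀ σ y, 0 ≤ w σ y := fun σ y => div_nonneg (pp_nonneg r σ y) ha0.le
  have hwsum : ∀ σ, ∑ y, w σ y ≤ N := by
    intro σ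
    rw [hw]; simp only
    rw [← Finset.sum_div, div_le_iff₀ ha0]
    have : (N:ℝ) * a = n := by rw [ha]; field_simp
    rw [this]; exact sum_pp_le r σ
  have e1 : ∑ σ ∈ T, pS r σ * ∑ y, pp r σ y * Real.log (pp r σ y / a)
      = ∑ x, Pdist N n x * ∑ t, Real.log (w (r x) (x t)) := by
    calc _ = ∑ σ ∈ T, ∑ y, pW r σ y * Real.log (w σ y) := by
          apply Finset.sum_congr rfl
          intro σ _
          rw [Finset.mul_sum]
          apply Finset.sum_congr rfl
          intro y _
          rw [← mul_assoc, pS_mul_pp]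
      _ = ∑ y, ∑ σ ∈ T, pW r σ y * Real.log (w σ y) := Finset.sum_comm
      _ = ∑ y, ∑ x, (if y ∈ Set.range x then Pdist N n x else 0) * Real.log (w (r x) y) := by
          apply Finset.sum_congr rfl
          intro y _
          exact exp_push r (fun x => if y ∈ Set.range x then Pdist N n x else 0) (fun σ => Real.log (w σ y))
      _ = ∑ x, ∑ y, (if y ∈ Set.range x then Pdist N n x else 0) * Real.log (w (r x) y) := Finset.sum_comm
      _ = _ := by
          apply Finset.sum_congr rfl
          intro x _
          exact (sum_range_ite x (fun y => Real.log (w (r x) y))).symm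
  rw [e1]
  set M : ℝ := T.card * (N+1) with hM
  have hM0 : 0 < M := by positivity
  have h2 : ∀ x, Pdist N n x * ∑ t, Real.log (w (r x) (x t)) ≤
      Pdist N n x * (Real.log M - 1) + Pdist N n x * (∏ t, w (r x) (x t)) / M := by
    intro x
    rcases (Pdist_nonneg N n x).eq_or_lt with h0 | h0
    · rw [← h0]; simp
    have hpos : ∀ t, 0 < w (r x) (x t) := by
      intro t
      have h3 : Pdist N n x ≤ pW r (r x) (x t) := by
        unfold pW
        refine le_trans (le_of_eq ?_) (Finset.single_le_sum
          (f := fun z => if r z = r x then (if x t ∈ Set.range z then Pdist N n z else 0) else 0) ?_ (Finset.mem_univ x))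
        · simp
        · intro z _; have := Pdist_nonneg N n z
          split_ifs <;> simp [this]
      have h4 : 0 < pW r (r x) (x t) := h0.trans_le h3
      have h5 : 0 < pS r (r x) := h4.trans_le (pW_le r _ _)
      exact div_pos (div_pos h4 h5) ha0
    have hprod : 0 < ∏ t, w (r x) (x t) := Finset.prod_pos fun t _ => hpos t
    have h6 := Real.log_le_sub_one_of_pos (div_pos hprod hM0)
    rw [Real.log_div hprod.ne' hM0.ne', Real.log_prod (fun t _ => (hpos t).ne')] at h6
    calc _ ≤ Pdist N n x * (Real.log M - 1 + (∏ t, w (r x) (x t)) / M) := by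
          gcongr; linarith
      _ = _ := by ring
  have h3 : ∑ x, Pdist N n x * (∏ t, w (r x) (x t)) ≤ M := by
    calc _ ≤ ∑ x, ∑ σ ∈ T, Pdist N n x * (∏ t, w σ (x t)) := by
          apply Finset.sum_le_sum
          intro x _
          refine Finset.single_le_sum (f := fun σ => Pdist N n x * (∏ t, w σ (x t))) ?_
            (Finset.mem_image_of_mem r (Finset.mem_univ x))
          intro σ _
          exact mul_nonneg (Pdist_nonneg N n x) (Finset.prod_nonneg fun t _ => hw0 _ _)
      _ = ∑ σ ∈ T, ∑ x, Pdist N n x * (∏ t, w σ (x t)) := Finset.sum_comm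
      _ ≤ ∑ σ ∈ T, ((N:ℝ)+1) := by
          apply Finset.sum_le_sum
          intro σ _
          exact weakMac N n hn hnN (w σ) (hw0 σ) (hwsum σ)
      _ = M := by simp [hM]; ring
  calc _ ≤ ∑ x, (Pdist N n x * (Real.log M - 1) + Pdist N n x * (∏ t, w (r x) (x t)) / M) :=
        Finset.sum_le_sum fun x _ => h2 x
    _ = (Real.log M - 1) + (∑ x, Pdist N n x * (∏ t, w (r x) (x t))) / M := by
        rw [Finset.sum_add_distrib, ← Finset.sum_mul, Pdist_sum N n hnN.le, Finset.sum_div, one_mul]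
    _ ≤ (Real.log M - 1) + 1 := by
        gcongr
        exact div_le_one_of_le₀ h3 hM0.le
    _ = _ := by rw [hM, Real.log_mul hTc.ne' (by positivity)]; ring

end

lemma log_sum {ι : Type*} (s : Finset ι) (u v : ι → ℝ) (hu : ∀ i ∈ s, 0 ≤ u i) (hv : ∀ i ∈ s, 0 < v i) :
    (∑ i ∈ s, u i) * Real.log ((∑ i ∈ s, u i) / ∑ i ∈ s, v i) ≤ ∑ i ∈ s, u i * Real.log (u i / v i) := by
  set U := ∑ i ∈ s, u i with hU
  set V := ∑ i ∈ s, v i with hV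
  have hU0 : 0 ≤ U := Finset.sum_nonneg hu
  rcases hU0.eq_or_lt with h0 | h0
  · have h1 : ∀ i ∈ s, u i = 0 := (Finset.sum_eq_zero_iff_of_nonneg hu).mp h0.symm
    rw [← h0, zero_mul]
    apply Finset.sum_nonneg
    intro i hi; rw [h1 i hi]; simp
  have hne : s.Nonempty := by
    by_contra h
    rw [Finset.not_nonempty_iff_eq_empty] at h
    rw [hU, h] at h0; simp at h0
  have hV0 : 0 < V := Finset.sum_pos hv hne
  have hc : 0 < U / V := div_pos h0 hV0
  have h1 : ∀ i ∈ s, u i * Real.log (U/V) + (u i - v i * (U/V)) ≤ u i * Real.log (u i / v i) := by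
    intro i hi
    rcases (hu i hi).eq_or_lt with h2 | h2
    · rw [← h2]
      have := mul_nonneg (hv i hi).le hc.le
      simp only [zero_mul, zero_sub]; linarith
    have hvi := hv i hi
    have h3 := Real.one_sub_inv_le_log_of_pos (div_pos (div_pos h2 hvi) hc)
    rw [Real.log_div (div_pos h2 hvi).ne' hc.ne'] at h3
    have h4 := mul_le_mul_of_nonneg_left h3 h2.le
    have h5 : u i * (1 - (u i / v i / (U/V))⁻¹) = u i - v i * (U/V) := by
      field_simp
    linarith
  calc U * Real.log (U/V) = ∑ i ∈ s, (u i * Real.log (U/V) + (u i - v i * (U/V))) := by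
        rw [Finset.sum_add_distrib, ← Finset.sum_mul, Finset.sum_sub_distrib, ← Finset.sum_mul,
          ← hU, ← hV]
        field_simp; ring
    _ ≤ _ := Finset.sum_le_sum h1

lemma sum_snoc (N n : ℕ) (F : (Fin (n+1) → Fin N) → ℝ) :
    ∑ x, F x = ∑ z : Fin n → Fin N, ∑ y : Fin N, F (Fin.snoc (α := fun _ => Fin N) z y) := by
  rw [← (Fin.snocEquiv (fun _ : Fin (n+1) => Fin N)).sum_comp, Fintype.sum_prod_type, Finset.sum_comm]
  rfl

lemma run_snoc {N n : ℕ} (A : ℕ → List Bool → Fin N → List Bool) (z : Fin n → Fin N) (y : Fin N)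
    (i : ℕ) (hi : i ≤ n) :
    streamRun A (Fin.snoc (α := fun _ => Fin N) z y) i = streamRun A z i := by
  induction i with
  | zero => rfl
  | succ i ih =>
    have h1 : i < n := by omega
    have h2 : i < n + 1 := by omega
    have h3 : Fin.snoc (α := fun _ => Fin N) z y ⟨i, h2⟩ = z ⟨i, h1⟩ := by
      have : (⟨i, h2⟩ : Fin (n+1)) = Fin.castSucc ⟨i, h1⟩ := rfl
      rw [this, Fin.snoc_castSucc]
    simp only [streamRun, h1, h2, dif_pos, h3, ih (by omega)]

lemma run_snoc_last {N n : ℕ} (A : ℕ → List Bool → Fin N → List Bool) (z : Fin n → Fin N) (y : Fin N) :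
    streamRun A (Fin.snoc (α := fun _ => Fin N) z y) (n+1) = A (n+1) (streamRun A z n) y := by
  have h2 : n < n + 1 := by omega
  have h3 : Fin.snoc (α := fun _ => Fin N) z y ⟨n, h2⟩ = y := by
    have : (⟨n, h2⟩ : Fin (n+1)) = Fin.last n := rfl
    rw [this, Fin.snoc_last]
  rw [streamRun, dif_pos h2, h3, run_snoc A z y n le_rfl]

lemma Pdist_snoc {N n : ℕ} (hn : n < N) (z : Fin n → Fin N) (y : Fin N) :
    Pdist N (n+1) (Fin.snoc (α := fun _ => Fin N) z y) =
      (Pdist N n z - if y ∈ Set.range z then Pdist N n z else 0) / ((N:ℝ) - n) := by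
  have hNn : (0:ℝ) < (N:ℝ) - n := by
    have : (n:ℝ) < N := by exact_mod_cast hn
    linarith
  have hdesc : (0:ℝ) < N.descFactorial n := by
    exact_mod_cast Nat.descFactorial_pos.mpr hn.le
  unfold Pdist
  simp only [Fin.snoc_injective_iff]
  by_cases h1 : Function.Injective z
  · by_cases h2 : y ∈ Set.range z
    · simp [h1, h2]
    · simp only [h1, h2, not_false_eq_true, and_self, if_true, if_false, sub_zero]
      rw [Nat.descFactorial_succ]
      push_cast [Nat.cast_sub hn.le]
      field_simp
  · simp [h1]

lemma kl_eq {N n : ℕ} (A : ℕ → List Bool → Fin N → List Bool) (μ ν : (Fin n → Fin N) → ℝ) :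
    klDiv (outDist A μ) (outDist A ν) = ∑ σ ∈ Finset.univ.image (fun x : Fin n → Fin N => streamRun A x n),
      outDist A μ σ * Real.log (outDist A μ σ / outDist A ν σ) := by
  unfold klDiv
  apply tsum_eq_sum
  intro σ hσ
  have : outDist A μ σ = 0 := by
    unfold outDist
    apply Finset.sum_eq_zero
    intro x _
    rw [if_neg]
    intro h
    exact hσ (Finset.mem_image.mpr ⟨x, Finset.mem_univ _, h⟩)
  rw [this, zero_mul]

lemma out_pos {N n : ℕ} (hN : 0 < N) (A : ℕ → List Bool → Fin N → List Bool) (σ : List Bool)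
    (hσ : σ ∈ Finset.univ.image (fun x : Fin n → Fin N => streamRun A x n)) :
    0 < outDist A (Qdist N n) σ := by
  obtain ⟨x, _, hx⟩ := Finset.mem_image.mp hσ
  unfold outDist
  have hN' : (0:ℝ) < N := by exact_mod_cast hN
  apply Finset.sum_pos'
  · intro z _; unfold Qdist; split_ifs <;> positivity
  · exact ⟨x, Finset.mem_univ _, by rw [if_pos hx]; unfold Qdist; positivity⟩

lemma out_snoc {N n : ℕ} (A : ℕ → List Bool → Fin N → List Bool) (μ : (Fin (n+1) → Fin N) → ℝ)
    (J : List Bool → Fin N → ℝ)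
    (hJ : ∀ σ y, J σ y = ∑ z : Fin n → Fin N, if streamRun A z n = σ then
      μ (Fin.snoc (α := fun _ => Fin N) z y) else 0) (τ : List Bool) :
    outDist A μ τ = ∑ k ∈ (Finset.univ.image (fun x : Fin n → Fin N => streamRun A x n) ×ˢ
      (Finset.univ : Finset (Fin N))).filter (fun k => A (n+1) k.1 k.2 = τ), J k.1 k.2 := by
  unfold outDist
  rw [sum_snoc, Finset.sum_filter, Finset.sum_product, Finset.sum_comm]
  simp only [run_snoc_last]
  rw [Finset.sum_comm (s := Finset.univ.image _)]
  apply Finset.sum_congr rfl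
  intro y _
  have := exp_push (fun z : Fin n → Fin N => streamRun A z n)
    (fun z => μ (Fin.snoc (α := fun _ => Fin N) z y)) (fun σ => if A (n+1) σ y = τ then 1 else 0)
  simp only [mul_ite, mul_one, mul_zero] at this
  rw [← this]
  apply Finset.sum_congr rfl
  intro σ _
  rw [hJ]

lemma step {N n : ℕ} (hn : n < N) (A : ℕ → List Bool → Fin N → List Bool)
    (r : (Fin n → Fin N) → List Bool) (hr : r = fun x => streamRun A x n) :
    klDiv (outDist A (Pdist N (n+1))) (outDist A (Qdist N (n+1))) ≤
      klDiv (outDist A (Pdist N n)) (outDist A (Qdist N n)) +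
      (∑ σ ∈ Finset.univ.image r, pS r σ * ∑ y, (pp r σ y - (n:ℝ)/N)^2 / (1 - (n:ℝ)/N)^2) / N := by
  have hNn : (0:ℝ) < (N:ℝ) - n := by
    have : (n:ℝ) < N := by exact_mod_cast hn
    linarith
  have hN : 0 < N := by omega
  have hN0 : (0:ℝ) < N := by exact_mod_cast hN
  set a : ℝ := (n:ℝ)/N with ha
  have ha1 : 0 < 1 - a := by
    rw [ha, sub_pos, div_lt_one hN0]; linarith
  have hNa : (N:ℝ) - n = N * (1-a) := by rw [ha]; field_simp
  set T := Finset.univ.image r with hT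
  have hT' : T = Finset.univ.image (fun x : Fin n → Fin N => streamRun A x n) := by rw [hT, hr]
  have hpS : ∀ σ, outDist A (Pdist N n) σ = pS r σ := by
    intro σ; rw [hr]; rfl
  set JP : List Bool → Fin N → ℝ := fun σ y => pS r σ * (1 - pp r σ y) / (N * (1-a)) with hJP
  set JQ : List Bool → Fin N → ℝ := fun σ y => outDist A (Qdist N n) σ / N with hJQ
  have hJP' : ∀ σ y, JP σ y = ∑ z : Fin n → Fin N, if streamRun A z n = σ then
      Pdist N (n+1) (Fin.snoc (α := fun _ => Fin N) z y) else 0 := by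
    intro σ y
    rw [hJP]; simp only
    rw [mul_sub, pS_mul_pp, mul_one, ← hNa]
    unfold pS pW
    rw [← Finset.sum_sub_distrib, Finset.sum_div, hr]
    apply Finset.sum_congr rfl
    intro z _
    rw [Pdist_snoc hn]
    by_cases h : streamRun A z n = σ
    · simp [h]
    · simp [h]
  have hJQ' : ∀ σ y, JQ σ y = ∑ z : Fin n → Fin N, if streamRun A z n = σ then
      Qdist N (n+1) (Fin.snoc (α := fun _ => Fin N) z y) else 0 := by
    intro σ y
    rw [hJQ]; simp only
    unfold outDist Qdist
    rw [Finset.sum_div]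
    apply Finset.sum_congr rfl
    intro z _
    by_cases h : streamRun A z n = σ
    · simp only [h, if_true]; rw [pow_succ]; field_simp
    · simp [h]
  have hJP0 : ∀ σ y, 0 ≤ JP σ y := by
    intro σ y
    have h1 := pS_nonneg r σ
    have h2 := pp_le_one r σ y
    exact div_nonneg (mul_nonneg h1 (by linarith)) (by positivity)
  have hJQ0 : ∀ σ ∈ T, ∀ y, 0 < JQ σ y := by
    intro σ hσ y
    exact div_pos (out_pos hN A σ (hT' ▸ hσ)) hN0
  set T' := Finset.univ.image (fun x : Fin (n+1) → Fin N => streamRun A x (n+1)) with hT'2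
  -- data processing
  have dp : klDiv (outDist A (Pdist N (n+1))) (outDist A (Qdist N (n+1))) ≤
      ∑ k ∈ T ×ˢ (Finset.univ : Finset (Fin N)), JP k.1 k.2 * Real.log (JP k.1 k.2 / JQ k.1 k.2) := by
    rw [kl_eq]
    have hmap : ∀ k ∈ T ×ˢ (Finset.univ : Finset (Fin N)), A (n+1) k.1 k.2 ∈ T' := by
      intro k hk
      obtain ⟨z, _, hz⟩ := Finset.mem_image.mp (Finset.mem_product.mp hk).1
      refine Finset.mem_image.mpr ⟨Fin.snoc (α := fun _ => Fin N) z k.2, Finset.mem_univ _, ?_⟩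
      rw [run_snoc_last, ← hz, hr]
    rw [← Finset.sum_fiberwise_of_maps_to hmap]
    apply Finset.sum_le_sum
    intro τ _
    rw [out_snoc A _ JP hJP', out_snoc A _ JQ hJQ', ← hT']
    apply log_sum
    · intro k _; exact hJP0 _ _
    · intro k hk
      exact hJQ0 k.1 (Finset.mem_product.mp (Finset.mem_filter.mp hk).1).1 k.2
  refine dp.trans ?_
  rw [Finset.sum_product, kl_eq, ← hT', Finset.sum_div, ← Finset.sum_add_distrib]
  apply Finset.sum_le_sum
  intro σ hσ
  rw [hpS]
  have hQ := out_pos hN A σ (hT' ▸ hσ)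
  set Qs := outDist A (Qdist N n) σ with hQs
  rcases (pS_nonneg r σ).eq_or_lt with h0 | h0
  · have : ∀ y, JP σ y = 0 := by intro y; rw [hJP]; simp only; rw [← h0]; simp
    simp [this, ← h0]
  set v : Fin N → ℝ := fun y => (1 - pp r σ y)/(1-a) with hv
  have hv0 : ∀ y, 0 ≤ v y := by
    intro y
    have h2 := pp_le_one r σ y
    exact div_nonneg (by linarith) ha1.le
  have hvsum : ∑ y, v y = N := by
    rw [hv]; simp only
    rw [← Finset.sum_div, Finset.sum_sub_distrib, sum_pp r σ h0.ne']
    simp only [Finset.sum_const, Finset.card_univ, Fintype.card_fin, nsmul_eq_mul, mul_one]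
    rw [hNa]; field_simp
  have hJv : ∀ y, JP σ y = pS r σ / N * v y := by
    intro y; rw [hJP, hv]; simp only; field_simp
  have key : ∀ y, JP σ y * Real.log (JP σ y / JQ σ y) ≤
      pS r σ / N * (v y * Real.log (pS r σ / Qs) + (v y - 1)^2 + (v y - 1)) := by
    intro y
    rw [hJv]
    rcases (hv0 y).eq_or_lt with h1 | h1
    · rw [← h1]; simp
    have h2 : pS r σ / N * v y / JQ σ y = (pS r σ / Qs) * v y := by
      rw [hJQ]; simp only; rw [← hQs]; field_simp
    rw [h2, Real.log_mul (div_pos h0 hQ).ne' h1.ne', mul_assoc]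
    apply mul_le_mul_of_nonneg_left _ (by positivity)
    have h3 := mul_le_mul_of_nonneg_left (Real.log_le_sub_one_of_pos h1) h1.le
    nlinarith
  refine (Finset.sum_le_sum fun y _ => key y).trans (le_of_eq ?_)
  rw [← Finset.mul_sum, Finset.sum_add_distrib, Finset.sum_add_distrib, ← Finset.sum_mul,
    Finset.sum_sub_distrib, hvsum]
  have h4 : ∀ y, (pp r σ y - a)^2/(1-a)^2 = (v y - 1)^2 := by
    intro y; rw [hv]; simp only
    rw [div_sub_one ha1.ne', div_pow]; congr 1; ring
  simp only [h4]
  simp only [Finset.sum_const, Finset.card_univ, Fintype.card_fin, nsmul_eq_mul, mul_one, sub_self, add_zero]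
  field_simp

lemma mb_pred {N n : ℕ} (hN : 0 < N) (A : ℕ → List Bool → Fin N → List Bool) (s : ℕ → ℕ)
    (h : MemoryBounded N (n+1) A s) : MemoryBounded N n A s := by
  intro x i h1 h2
  have := h (Fin.snoc (α := fun _ => Fin N) x ⟨0, hN⟩) i h1 (by omega)
  rwa [run_snoc A x _ i h2] at this

lemma mb_le {N q : ℕ} (hN : 0 < N) (A : ℕ → List Bool → Fin N → List Bool) (s : ℕ → ℕ)
    (h : MemoryBounded N q A s) (n : ℕ) (hn : n ≤ q) : MemoryBounded N n A s := by
  induction hn using Nat.decreasingInduction with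
  | self => exact h
  | of_succ k _ ih => exact mb_pred hN A s ih

lemma mb_card {N n : ℕ} (hn : 1 ≤ n) (A : ℕ → List Bool → Fin N → List Bool) (s : ℕ → ℕ)
    (h : MemoryBounded N n A s) :
    (Finset.univ.image (fun x : Fin n → Fin N => streamRun A x n)).card ≤ 2 ^ (s n) := by
  have h1 : (Finset.univ.image (fun x : Fin n → Fin N => streamRun A x n)) ⊆
      (Finset.univ : Finset (List.Vector Bool (s n))).image (fun v => v.1) := by
    intro σ hσ
    obtain ⟨x, _, hx⟩ := Finset.mem_image.mp hσ
    refine Finset.mem_image.mpr ⟨⟨σ, ?_⟩, Finset.mem_univ _, rfl⟩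
    rw [← hx]; exact h x n hn le_rfl
  refine (Finset.card_le_card h1).trans (Finset.card_image_le.trans ?_)
  rw [Finset.card_univ, card_vector]; simp

lemma kl_zero (N : ℕ) (A : ℕ → List Bool → Fin N → List Bool) :
    klDiv (outDist A (Pdist N 0)) (outDist A (Qdist N 0)) = 0 := by
  rw [kl_eq]
  apply Finset.sum_eq_zero
  intro σ _
  have : outDist A (Pdist N 0) σ = outDist A (Qdist N 0) σ := by
    unfold outDist
    apply Finset.sum_congr rfl
    intro x _
    simp [Pdist, Qdist, Function.injective_of_subsingleton]
  rw [this]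
  by_cases h : outDist A (Qdist N 0) σ = 0
  · rw [h]; simp
  · rw [div_self h]; simp

lemma step_bound {N n : ℕ} (δ ε L : ℝ) (hδ : 0 < δ) (hn : 1 ≤ n) (hnN : n < N)
    (hε : ∀ a : ℝ, 0 < a → a ≤ ε → ∀ p : ℝ, 0 ≤ p → p ≤ 1 →
      (p - a)^2/(1-a)^2 * Real.log (1/a) ≤ (1+δ) * (p * Real.log (p/a) - p + a))
    (hna : (n:ℝ)/N ≤ ε) (hL : 0 < L) (hL2 : L ≤ Real.log (N/n))
    (r : (Fin n → Fin N) → List Bool) (m : ℕ) (hm : (Finset.univ.image r).card ≤ 2^m) :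
    (∑ σ ∈ Finset.univ.image r, pS r σ * ∑ y, (pp r σ y - (n:ℝ)/N)^2 / (1 - (n:ℝ)/N)^2) / N ≤
      (1+δ)/(N*L) * (m * Real.log 2 + Real.log (N+1)) := by
  have hn0 : (0:ℝ) < n := by exact_mod_cast hn
  have hN0 : (0:ℝ) < N := by exact_mod_cast (by omega : 0 < N)
  have hinfo := info r hn hnN
  set a : ℝ := (n:ℝ)/N with ha
  have ha0 : 0 < a := by positivity
  have hLa : L ≤ Real.log (1/a) := by rw [ha, one_div_div]; exact hL2
  have : Nonempty (Fin N) := ⟨⟨0, by omega⟩⟩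
  have hTc : (0:ℝ) < (Finset.univ.image r).card := by
    have : 0 < (Finset.univ.image r).card := Finset.card_pos.mpr (Finset.Nonempty.image Finset.univ_nonempty r)
    exact_mod_cast this
  have hlogT : Real.log ((Finset.univ.image r).card) ≤ m * Real.log 2 := by
    rw [← Real.log_pow]
    apply Real.log_le_log hTc
    exact_mod_cast hm
  have h1 : (∑ σ ∈ Finset.univ.image r, pS r σ * ∑ y, (pp r σ y - a)^2 / (1 - a)^2) * L ≤
      (1+δ) * ∑ σ ∈ Finset.univ.image r, pS r σ * ∑ y, pp r σ y * Real.log (pp r σ y / a) := by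
    rw [Finset.sum_mul, Finset.mul_sum]
    apply Finset.sum_le_sum
    intro σ _
    rcases (pS_nonneg r σ).eq_or_lt with h0 | h0
    · rw [← h0]; simp
    have h2 : (∑ y, (pp r σ y - a)^2 / (1 - a)^2) * L ≤ (1+δ) * ∑ y, pp r σ y * Real.log (pp r σ y / a) := by
      have h3 : ∑ y, pp r σ y * Real.log (pp r σ y / a) = ∑ y, (pp r σ y * Real.log (pp r σ y / a) - pp r σ y + a) := by
        rw [Finset.sum_add_distrib, Finset.sum_sub_distrib, sum_pp r σ h0.ne']
        simp only [Finset.sum_const, Finset.card_univ, Fintype.card_fin, nsmul_eq_mul]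
        have h9 : (N:ℝ) * a = n := by rw [ha]; field_simp
        rw [h9]; ring
      rw [h3, Finset.sum_mul, Finset.mul_sum]
      apply Finset.sum_le_sum
      intro y _
      refine le_trans ?_ (hε a ha0 hna _ (pp_nonneg r σ y) (pp_le_one r σ y))
      gcongr
    calc _ = pS r σ * ((∑ y, (pp r σ y - a)^2 / (1 - a)^2) * L) := by ring
      _ ≤ pS r σ * ((1+δ) * ∑ y, pp r σ y * Real.log (pp r σ y / a)) := by gcongr
      _ = _ := by ring
  rw [div_le_iff₀ hN0]
  have h5 : (1+δ)/(N*L) * (m * Real.log 2 + Real.log (N+1)) * N = ((1+δ) * (m * Real.log 2 + Real.log (N+1))) / L := by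
    field_simp
  rw [h5, le_div_iff₀ hL]
  refine h1.trans ?_
  gcongr
  linarith

lemma kl_bound {N q : ℕ} (δ ε : ℝ) (hδ : 0 < δ) (hε2 : ε ≤ 1/2)
    (hε : ∀ a : ℝ, 0 < a → a ≤ ε → ∀ p : ℝ, 0 ≤ p → p ≤ 1 →
      (p - a)^2/(1-a)^2 * Real.log (1/a) ≤ (1+δ) * (p * Real.log (p/a) - p + a))
    (hN : 0 < N) (hq : (q:ℝ) ≤ ε * N) (s : ℕ → ℕ)
    (A : ℕ → List Bool → Fin N → List Bool) (hA : MemoryBounded N q A s) (n : ℕ) (hnq : n + 1 ≤ q) :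
    klDiv (outDist A (Pdist N (n+1))) (outDist A (Qdist N (n+1))) ≤
      (1+δ)/(N*Real.log (N/q)) * ∑ i ∈ Finset.Icc 1 n, (s i * Real.log 2 + Real.log (N+1)) := by
  have hN0 : (0:ℝ) < N := by exact_mod_cast hN
  have hq0 : (0:ℝ) < q := by exact_mod_cast (by omega : 0 < q)
  have hqN : (q:ℝ) < N := by nlinarith
  have hqN' : q < N := by exact_mod_cast hqN
  have hL : 0 < Real.log (N/q) := Real.log_pos (by rw [lt_div_iff₀ hq0]; linarith)
  induction n with
  | zero =>
    have := step (n := 0) hN A _ rfl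
    rw [kl_zero, zero_add] at this
    refine this.trans (le_of_eq ?_)
    simp [pp, pW]
  | succ n ih =>
    have h1 := ih (by omega)
    have h2 := step (n := n+1) (by omega) A _ rfl
    have hn0 : (0:ℝ) < ((n+1:ℕ):ℝ) := by positivity
    have hnq' : ((n+1:ℕ):ℝ) ≤ q := by exact_mod_cast (by omega : n+1 ≤ q)
    have h3 := step_bound (n := n+1) δ ε (Real.log (N/q)) hδ (by omega) (by omega) hε
      (by rw [div_le_iff₀ hN0]; linarith) hL
      (by apply Real.log_le_log (by positivity); gcongr)
      (fun x => streamRun A x (n+1)) (s (n+1))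
      (mb_card (by omega) A s (mb_le hN A s hA (n+1) (by omega)))
    rw [Finset.sum_Icc_succ_top (by omega), mul_add]
    linarith

/-- For every `C > 0` and `δ > 0` there exist `ε > 0` and `N₀` such that for all
`N ≥ N₀`, all `q ≤ εN`, all nonnegative integers `s_1, …, s_q` with `s_i ≤ C·N`
for all `i ∈ [q]` (and satisfying `s_1 ≤ ⌈log₂ N⌉` and `s_{i+1} ≤ s_i + ⌈log₂ N⌉`),
and every `(s_1, …, s_q)`-memory-bounded streaming algorithm `A`:
`D_KL(P_A ‖ Q_A) ≤ (1+δ)·(Σ_{i=1}^{q-1} s_i + q log₂ N) / (N log₂(N/q))`. -/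
theorem stmt_0 :
    ∀ C > (0 : ℝ), ∀ δ > (0 : ℝ), ∃ ε > (0 : ℝ), ∃ N₀ : ℕ, ∀ N : ℕ, N₀ ≤ N →
      ∀ q : ℕ, (q : ℝ) ≤ ε * N →
        ∀ s : ℕ → ℕ,
          (∀ i : ℕ, 1 ≤ i → i ≤ q → (s i : ℝ) ≤ C * N) →
          s 1 ≤ Nat.clog 2 N →
          (∀ i : ℕ, 1 ≤ i → i + 1 ≤ q → s (i + 1) ≤ s i + Nat.clog 2 N) →
          ∀ A : ℕ → List Bool → Fin N → List Bool, MemoryBounded N q A s →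
            klDiv (outDist A (Pdist N q)) (outDist A (Qdist N q)) ≤
              (1 + δ) *
                (((∑ i ∈ Finset.Icc 1 (q - 1), (s i : ℝ)) + q * Real.logb 2 N) /
                  (N * Real.logb 2 ((N : ℝ) / q))) := by

  intro C _ δ hδ
  obtain ⟨ε, hε0, hε2, hε⟩ := analytic δ hδ
  refine ⟨ε, hε0, 1, ?_⟩
  intro N hN q hq s _ _ _ A hA
  rcases Nat.eq_zero_or_pos q with rfl | hqpos
  · rw [kl_zero]; simp
  obtain ⟨n, rfl⟩ : ∃ n, q = n + 1 := ⟨q - 1, by omega⟩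
  have hN0 : (0:ℝ) < N := by exact_mod_cast (by omega : 0 < N)
  have hb := kl_bound δ ε hδ hε2 hε (by omega) hq s A hA n le_rfl
  refine hb.trans ?_
  have hn0 : (0:ℝ) ≤ n := Nat.cast_nonneg n
  have hq' : (n:ℝ) + 1 ≤ N / 2 := by push_cast at hq; nlinarith
  have hN2 : (2:ℝ) ≤ N := by linarith
  have hL : 0 < Real.log (N/((n+1:ℕ):ℝ)) := Real.log_pos (by
    rw [lt_div_iff₀ (by positivity)]; push_cast; linarith)
  have hl2 : 0 < Real.log 2 := Real.log_pos (by norm_num)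
  have hlogN : 1/2 ≤ Real.log N := by
    have h1 := Real.log_two_gt_d9
    have h2 := Real.log_le_log (by norm_num) hN2
    linarith
  have hlog1 : Real.log ((N:ℝ)+1) ≤ Real.log N + 1/N := by
    have h1 : (N:ℝ) + 1 = N * (1 + 1/N) := by field_simp
    rw [h1, Real.log_mul hN0.ne' (by positivity)]
    have := Real.log_le_sub_one_of_pos (show (0:ℝ) < 1 + 1/N by positivity)
    linarith
  have hkey : (n:ℝ) * Real.log ((N:ℝ)+1) ≤ ((n+1:ℕ):ℝ) * Real.log N := by
    have h1 : (n:ℝ) * (1/N) ≤ 1/2 := by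
      rw [mul_one_div, div_le_iff₀ hN0]; linarith
    have h2 := mul_le_mul_of_nonneg_left hlog1 hn0
    push_cast
    nlinarith
  rw [Finset.sum_add_distrib, ← Finset.sum_mul]
  simp only [Finset.sum_const, Nat.card_Icc, Nat.add_sub_cancel, nsmul_eq_mul]
  have e : (1 + δ) * (((∑ i ∈ Finset.Icc 1 n, (s i : ℝ)) + ((n+1:ℕ):ℝ) * Real.logb 2 N) /
                  (N * Real.logb 2 ((N : ℝ) / ((n+1:ℕ):ℝ)))) =
      (1+δ)/(N*Real.log (N/((n+1:ℕ):ℝ))) * ((∑ i ∈ Finset.Icc 1 n, (s i : ℝ)) * Real.log 2 + ((n+1:ℕ):ℝ) * Real.log N) := by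
    unfold Real.logb
    set L := Real.log (N/((n+1:ℕ):ℝ))
    field_simp
  rw [e]
  gcongr
end

section
/- For every constant ε > 0 and every δ > 0 there exists N₀ such that for all N ≥ N₀, all q ≤ N^{1−ε}, all nonnegative integers s_1,…,s_q (satisfying s_1 ≤ ⌈log₂ N⌉ and s_{i+1} ≤ s_i + ⌈log₂ N⌉), and every (s_1,…,s_q)-memory-bounded streaming algorithm A, it holds that D_KL(P_A‖Q_A) ≤ (1+δ) · (Σ_{i=1}^{q−1} s_i + q·log₂ N)/(ε · N · log₂ N). -/
open scoped Classical

namespace SP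
open InformationTheory (klFun klFun_nonneg klFun_one)
open Finset

lemma logsum {ι : Type*} (S : Finset ι) (p r : ι → ℝ) (hp : ∀ i ∈ S, 0 ≤ p i)
    (hr : ∀ i ∈ S, 0 ≤ r i) (h0 : ∀ i ∈ S, r i = 0 → p i = 0) :
    (∑ i ∈ S, p i) * Real.log ((∑ i ∈ S, p i) / ∑ i ∈ S, r i) ≤
      ∑ i ∈ S, p i * Real.log (p i / r i) := by
  set P := ∑ i ∈ S, p i with hP
  set R := ∑ i ∈ S, r i with hR
  have hP0 : 0 ≤ P := Finset.sum_nonneg hp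
  have hR0 : 0 ≤ R := Finset.sum_nonneg hr
  rcases hP0.eq_or_lt with h | hPpos
  · have hz : ∀ i ∈ S, p i = 0 := (Finset.sum_eq_zero_iff_of_nonneg hp).1 h.symm
    rw [← h, Finset.sum_eq_zero]
    · simp
    · intro i hi; simp [hz i hi]
  have hRpos : 0 < R := by
    rcases hR0.eq_or_lt with h | h
    · exfalso
      have hz : ∀ i ∈ S, r i = 0 := (Finset.sum_eq_zero_iff_of_nonneg hr).1 h.symm
      have : P = 0 := Finset.sum_eq_zero (fun i hi => h0 i hi (hz i hi))
      linarith
    · exact h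
  have key : ∀ i ∈ S, p i - r i * (P / R) ≤ p i * Real.log (p i / r i) - p i * Real.log (P / R) := by
    intro i hi
    rcases (hp i hi).eq_or_lt with h | hpi
    · rw [← h]; simp
      exact mul_nonneg (hr i hi) (div_nonneg hP0 hR0)
    have hri : 0 < r i := by
      rcases (hr i hi).eq_or_lt with h | h
      · have := h0 i hi h.symm; linarith
      · exact h
    have hPR : 0 < P / R := div_pos hPpos hRpos
    have h1 : Real.log (r i * (P / R) / p i) ≤ r i * (P / R) / p i - 1 :=
      Real.log_le_sub_one_of_pos (by positivity)
    rw [Real.log_div (by positivity) (by positivity), Real.log_mul (by positivity) (by positivity)] at h1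
    rw [Real.log_div (by positivity) (by positivity)]
    have h2 := mul_le_mul_of_nonneg_left h1 hpi.le
    have h3 : p i * (r i * (P / R) / p i - 1) = r i * (P / R) - p i := by field_simp
    rw [h3] at h2
    nlinarith
  have := Finset.sum_le_sum key
  rw [Finset.sum_sub_distrib, Finset.sum_sub_distrib, ← Finset.sum_mul, ← Finset.sum_mul, ← hP, ← hR] at this
  have h3 : R * (P / R) = P := by field_simp
  rw [h3] at this
  linarith

lemma klFun_le_sq {t : ℝ} (ht : 0 ≤ t) : klFun t ≤ (t - 1) ^ 2 := by
  unfold klFun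
  rcases ht.eq_or_lt with h | h
  · rw [← h]; simp
  · have := Real.log_le_sub_one_of_pos h
    nlinarith

lemma klFun_le_lin {t : ℝ} (ht : 0 ≤ t) (h1 : t ≤ 1) : klFun t ≤ 1 - t := by
  unfold klFun
  have := Real.mul_log_nonpos ht h1
  linarith

lemma klFun_ge {t T : ℝ} (ht : 0 ≤ t) (hT : 1 ≤ T) (htT : t ≤ T) :
    (t - 1) ^ 2 / (4 * T) ≤ klFun t := by
  have h1 : (Real.sqrt t - 1) ^ 2 ≤ klFun t := by
    unfold klFun
    rcases ht.eq_or_lt with h | h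
    · rw [← h]; simp
    · have hs : 0 < Real.sqrt t := Real.sqrt_pos.2 h
      have h2 := Real.one_sub_inv_le_log_of_pos hs
      have h3 : Real.log t = 2 * Real.log (Real.sqrt t) := by
        rw [Real.log_sqrt ht]; ring
      have h4 : Real.sqrt t * Real.sqrt t = t := Real.mul_self_sqrt ht
      have h5 : t * (1 - (Real.sqrt t)⁻¹) = t - Real.sqrt t := by
        nth_rewrite 1 [← h4]
        nth_rewrite 4 [← h4]
        field_simp
      have h6 := mul_le_mul_of_nonneg_left h2 ht
      rw [h3]
      nlinarith
  refine le_trans ?_ h1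
  have h4 : Real.sqrt t ^ 2 = t := Real.sq_sqrt ht
  have hs : 0 ≤ Real.sqrt t := Real.sqrt_nonneg t
  rw [div_le_iff₀ (by positivity)]
  set s := Real.sqrt t
  have : (t - 1) ^ 2 = (s - 1) ^ 2 * (s + 1) ^ 2 := by rw [← h4]; ring
  rw [this]
  apply mul_le_mul_of_nonneg_left _ (sq_nonneg _)
  nlinarith [sq_nonneg (s - 1)]

lemma analytic (δ : ℝ) (hδ : 0 < δ) : ∃ L0 : ℝ, 0 < L0 ∧ ∀ a : ℝ, 0 < a → L0 ≤ -Real.log a →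
    ∀ p : ℝ, 0 ≤ p → p ≤ 1 → (-Real.log a) * klFun ((1 - p) / (1 - a)) ≤
      (1 + δ) * (a * klFun (p / a) + (1 - a) * klFun ((1 - p) / (1 - a))) := by
  set η := δ / (2 * (1 + δ)) with hη
  have hηpos : 0 < η := by positivity
  have hη1 : η ≤ 1 := by
    rw [hη, div_le_one (by positivity)]; linarith
  have hlim : Filter.Tendsto (fun L : ℝ => 16 * (L * Real.exp (-η * L))) Filter.atTop (nhds 0) := by
    have := (tendsto_rpow_mul_exp_neg_mul_atTop_nhds_zero 1 η hηpos).const_mul 16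
    simpa using this
  have hev := hlim.eventually (gt_mem_nhds (show (0:ℝ) < 1 by norm_num))
  obtain ⟨L1, hL1⟩ := Filter.eventually_atTop.1 hev
  refine ⟨max (max L1 1) (2 * (1 + δ) / δ), by positivity, ?_⟩
  intro a ha hL p hp hp1
  set L := -Real.log a with hLdef
  have hLL1 : L1 ≤ L := le_trans (le_trans (le_max_left _ _) (le_max_left _ _)) hL
  have hL1' : 1 ≤ L := le_trans (le_trans (le_max_right _ _) (le_max_left _ _)) hL
  have hL2 : 2 * (1 + δ) / δ ≤ L := le_trans (le_max_right _ _) hL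
  have hc := hL1 L hLL1
  have haL : a = Real.exp (-L) := by rw [hLdef, neg_neg, Real.exp_log ha]
  have ha2 : a ≤ 1 / 2 := by
    rw [haL, Real.exp_neg, one_div]
    apply inv_anti₀ (by norm_num)
    have := Real.add_one_le_exp L
    linarith
  set c := Real.exp (-η * L) with hcdef
  have hac : a ≤ c := by
    rw [haL, hcdef]; apply Real.exp_le_exp.2; nlinarith
  have hcpos : 0 < c := Real.exp_pos _
  have hb : 0 < 1 - a := by linarith
  have hu : 0 ≤ (1 - p) / (1 - a) := div_nonneg (by linarith) hb.le
  have hK : 0 ≤ klFun ((1 - p) / (1 - a)) := klFun_nonneg hu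
  have hK2 : 0 ≤ klFun (p / a) := klFun_nonneg (by positivity)
  suffices h : L * klFun ((1 - p) / (1 - a)) ≤ (1 + δ) * (a * klFun (p / a)) by
    have : 0 ≤ (1 + δ) * ((1 - a) * klFun ((1 - p) / (1 - a))) := by positivity
    linarith
  by_cases hpc : p ≤ c
  · have h1 : ((1 - p) / (1 - a) - 1) = (a - p) / (1 - a) := by field_simp; ring
    have h2 := klFun_le_sq hu
    rw [h1, div_pow] at h2
    have h3 : (p / a - 1) ^ 2 / (4 * (c / a)) ≤ klFun (p / a) := by
      apply klFun_ge (by positivity)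
      · rw [le_div_iff₀ ha]; linarith
      · gcongr
    have h4 : a * ((p / a - 1) ^ 2 / (4 * (c / a))) = (a - p) ^ 2 / (4 * c) := by
      field_simp; ring
    have h5 : (a - p) ^ 2 / (4 * c) ≤ a * klFun (p / a) := by
      rw [← h4]; exact mul_le_mul_of_nonneg_left h3 ha.le
    have h6 : L * ((a - p) ^ 2 / (1 - a) ^ 2) ≤ (a - p) ^ 2 / (4 * c) := by
      have e1 : L * ((a - p) ^ 2 / (1 - a) ^ 2) = (a - p) ^ 2 * (L / (1 - a) ^ 2) := by ring
      have e2 : (a - p) ^ 2 / (4 * c) = (a - p) ^ 2 * (1 / (4 * c)) := by ring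
      rw [e1, e2]
      apply mul_le_mul_of_nonneg_left _ (sq_nonneg _)
      rw [div_le_div_iff₀ (by positivity) (by positivity)]
      nlinarith
    calc L * klFun ((1 - p) / (1 - a)) ≤ L * ((a - p) ^ 2 / (1 - a) ^ 2) := by gcongr
      _ ≤ a * klFun (p / a) := h6.trans h5
      _ ≤ (1 + δ) * (a * klFun (p / a)) := by
        have : 0 ≤ a * klFun (p / a) := by positivity
        nlinarith
  · push Not at hpc
    have hp0 : 0 < p := hcpos.trans hpc
    have hu1 : (1 - p) / (1 - a) ≤ 1 := by
      rw [div_le_one hb]; linarith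
    have h1 := klFun_le_lin hu hu1
    have h2 : 1 - (1 - p) / (1 - a) ≤ p := by
      rw [sub_le_iff_le_add, ← sub_le_iff_le_add', le_div_iff₀ hb]
      nlinarith
    have hlogp : -η * L ≤ Real.log p := by
      rw [Real.le_log_iff_exp_le hp0]; exact hpc.le
    have h3 : a * klFun (p / a) = p * (Real.log p + L) + a - p := by
      unfold klFun
      rw [Real.log_div hp0.ne' ha.ne', hLdef]
      field_simp
      ring
    have h4 : p * (L * (1 - η) - 1) ≤ a * klFun (p / a) := by
      rw [h3]; nlinarith
    have h5 : L ≤ (1 + δ) * (L * (1 - η) - 1) := by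
      have : (1 + δ) * (1 - η) = 1 + δ / 2 := by rw [hη]; field_simp; ring
      rw [div_le_iff₀ hδ] at hL2
      nlinarith
    calc L * klFun ((1 - p) / (1 - a)) ≤ L * p := by
          apply mul_le_mul_of_nonneg_left (h1.trans h2); linarith
      _ ≤ (1 + δ) * (L * (1 - η) - 1) * p := by gcongr
      _ = (1 + δ) * (p * (L * (1 - η) - 1)) := by ring
      _ ≤ _ := by gcongr

lemma mode (N k : ℕ) (hk : k ≤ N) (hN : 0 < N) :
    1 ≤ ((N : ℝ) + 1) * ((N.choose k : ℝ) * ((k : ℝ) / N) ^ k * (1 - (k : ℝ) / N) ^ (N - k)) := by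
  set a : ℝ := (k : ℝ) / N with ha
  have hNr : (0 : ℝ) < N := by exact_mod_cast hN
  have ha0 : 0 ≤ a := by positivity
  have hkN : (k : ℝ) ≤ N := by exact_mod_cast hk
  have ha1 : a ≤ 1 := by rw [ha, div_le_one hNr]; exact hkN
  have haN : a * N = k := by rw [ha]; field_simp
  set t : ℕ → ℝ := fun j => (N.choose j : ℝ) * a ^ j * (1 - a) ^ (N - j) with ht
  have ht0 : ∀ j, 0 ≤ t j := fun j => by
    have : 0 ≤ 1 - a := by linarith
    simp only [ht]; positivity
  -- relation
  have hrel : ∀ j, j < N → t (j + 1) * ((j + 1 : ℝ) * (1 - a)) = t j * ((N - j : ℝ) * a) := by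
    intro j hj
    have h1 : (N.choose (j + 1) : ℝ) * (j + 1 : ℝ) = N.choose j * (N - j : ℝ) := by
      have := Nat.choose_succ_right_eq N j
      rw [← Nat.cast_sub hj.le]
      exact_mod_cast this
    have h2 : N - j = (N - (j + 1)) + 1 := by omega
    simp only [ht]
    rw [h2, pow_succ, pow_succ]
    linear_combination (a ^ j * a * (1 - a) ^ (N - (j + 1)) * (1 - a)) * h1
  have hup : ∀ j, j < k → t j ≤ t (j + 1) := by
    intro j hj
    have hjN : j < N := by omega
    have hr := hrel j hjN
    have hjk : (j : ℝ) + 1 ≤ k := by exact_mod_cast hj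
    have hc : (j + 1 : ℝ) * (1 - a) ≤ (N - j : ℝ) * a := by nlinarith
    have hpos : 0 < (N - j : ℝ) * a := by
      have : (0 : ℝ) < N - j := by linarith
      have : (0 : ℝ) < k := by linarith [(Nat.cast_nonneg j : (0 : ℝ) ≤ j)]
      positivity
    by_contra hlt
    push Not at hlt
    have h3 : t (j + 1) * ((j + 1 : ℝ) * (1 - a)) ≤ t (j + 1) * ((N - j : ℝ) * a) :=
      mul_le_mul_of_nonneg_left hc (ht0 _)
    have h4 := mul_lt_mul_of_pos_right hlt hpos
    linarith
  have hdown : ∀ j, k ≤ j → j < N → t (j + 1) ≤ t j := by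
    intro j hj hjN
    have hr := hrel j hjN
    have hjk : (k : ℝ) ≤ j := by exact_mod_cast hj
    have hjN' : (j : ℝ) + 1 ≤ N := by exact_mod_cast hjN
    have hj0 : (0 : ℝ) ≤ j := Nat.cast_nonneg j
    have hc : (N - j : ℝ) * a ≤ (j + 1 : ℝ) * (1 - a) := by nlinarith
    have hpos : 0 < (j + 1 : ℝ) * (1 - a) := by
      have : a < 1 := by rw [ha, div_lt_one hNr]; linarith
      have : 0 < 1 - a := by linarith
      positivity
    by_contra hlt
    push Not at hlt
    have h3 : t j * ((N - j : ℝ) * a) ≤ t j * ((j + 1 : ℝ) * (1 - a)) :=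
      mul_le_mul_of_nonneg_left hc (ht0 _)
    have h4 := mul_lt_mul_of_pos_right hlt hpos
    linarith
  have hmaxd : ∀ d, k + d ≤ N → t (k + d) ≤ t k := by
    intro d
    induction d with
    | zero => intro _; exact le_rfl
    | succ d ih =>
      intro h
      exact (hdown (k + d) (by omega) (by omega)).trans (ih (by omega))
  have hmaxu : ∀ d, d ≤ k → t (k - d) ≤ t k := by
    intro d
    induction d with
    | zero => intro _; exact le_rfl
    | succ d ih =>
      intro h
      have := hup (k - (d + 1)) (by omega)
      rw [show k - (d + 1) + 1 = k - d by omega] at this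
      exact this.trans (ih (by omega))
  have hmax : ∀ j ∈ Finset.range (N + 1), t j ≤ t k := by
    intro j hj
    rw [Finset.mem_range] at hj
    rcases le_total j k with h | h
    · have := hmaxu (k - j) (by omega)
      rwa [show k - (k - j) = j by omega] at this
    · have := hmaxd (j - k) (by omega)
      rwa [show k + (j - k) = j by omega] at this
  have hsum : ∑ j ∈ Finset.range (N + 1), t j = 1 := by
    have := add_pow a (1 - a) N
    rw [show a + (1 - a) = 1 by ring, one_pow] at this
    rw [this]
    apply Finset.sum_congr rfl
    intro j _
    simp only [ht]; ring
  have := Finset.sum_le_sum hmax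
  rw [hsum, Finset.sum_const, Finset.card_range, nsmul_eq_mul] at this
  push_cast at this
  exact this

end SP

namespace SP
open InformationTheory (klFun klFun_nonneg klFun_one)
open Finset

noncomputable def pr {k N : ℕ} (E : Finset (Fin k → Fin N)) (y : Fin N) : ℝ :=
  ((E.filter (fun x => ∃ i, x i = y)).card : ℝ) / E.card

lemma pr_nonneg {k N : ℕ} (E : Finset (Fin k → Fin N)) (y : Fin N) : 0 ≤ pr E y := by
  unfold pr; positivity

lemma pr_le_one {k N : ℕ} (E : Finset (Fin k → Fin N)) (y : Fin N) : pr E y ≤ 1 := by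
  unfold pr
  apply div_le_one_of_le₀ _ (by positivity)
  exact_mod_cast Finset.card_filter_le _ _

lemma card_mul_pr {k N : ℕ} (E : Finset (Fin k → Fin N)) (hE : E.Nonempty) (y : Fin N) :
    (E.card : ℝ) * pr E y = ((E.filter (fun x => ∃ i, x i = y)).card : ℝ) := by
  unfold pr
  have : (E.card : ℝ) ≠ 0 := by exact_mod_cast hE.card_pos.ne'
  field_simp

lemma card_mul_one_sub_pr {k N : ℕ} (E : Finset (Fin k → Fin N)) (hE : E.Nonempty) (y : Fin N) :
    (E.card : ℝ) * (1 - pr E y) = ((E.filter (fun x => ¬ ∃ i, x i = y)).card : ℝ) := by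
  rw [mul_sub, card_mul_pr E hE, mul_one, sub_eq_iff_eq_add]
  rw [add_comm]
  exact_mod_cast (Finset.card_filter_add_card_filter_not (s := E) (fun x => ∃ i, x i = y)).symm

lemma sum_pr {k N : ℕ} (E : Finset (Fin k → Fin N)) (hE : E.Nonempty)
    (hinj : ∀ x ∈ E, Function.Injective x) : ∑ y, pr E y = k := by
  have hc : (E.card : ℝ) ≠ 0 := by exact_mod_cast hE.card_pos.ne'
  apply mul_left_cancel₀ hc
  rw [Finset.mul_sum]
  simp_rw [card_mul_pr E hE, Finset.card_filter]
  push_cast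
  rw [Finset.sum_comm]
  rw [Finset.sum_congr rfl (g := fun _ => (k : ℝ))]
  · simp
  intro x hx
  rw [← Finset.sum_filter]
  simp only [Finset.sum_const, nsmul_eq_mul, mul_one]
  have : (Finset.univ.filter (fun y => ∃ i, x i = y)) = Finset.univ.image x := by
    ext y; simp
  rw [this, Finset.card_image_of_injective _ (hinj x hx)]
  simp

lemma fiber_card {k N : ℕ} (E : Finset (Fin k → Fin N))
    (hinj : ∀ x ∈ E, Function.Injective x) (S : Finset (Fin N)) :
    (E.filter (fun x => Finset.univ.image x = S)).card ≤ k.factorial := by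
  rcases (E.filter (fun x => Finset.univ.image x = S)).eq_empty_or_nonempty with h | ⟨x0, h⟩
  · rw [h]; simp
  rw [Finset.mem_filter] at h
  have hS : S.card = k := by
    rw [← h.2, Finset.card_image_of_injective _ (hinj x0 h.1)]; simp
  have hsub : (E.filter (fun x => Finset.univ.image x = S)) ⊆
      (Finset.univ : Finset (Fin k ↪ S)).image (fun e i => (e i : Fin N)) := by
    intro x hx
    rw [Finset.mem_filter] at hx
    rw [Finset.mem_image]
    refine ⟨⟨fun i => ⟨x i, by rw [← hx.2]; simp⟩, ?_⟩, Finset.mem_univ _, ?_⟩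
    · intro i j hij
      exact hinj x hx.1 (by simpa using hij)
    · rfl
  refine (Finset.card_le_card hsub).trans (Finset.card_image_le.trans ?_)
  rw [Finset.card_univ, Fintype.card_embedding_eq]
  simp [hS, Nat.descFactorial_self]

lemma entropy {k N : ℕ} (E : Finset (Fin k → Fin N)) (hE : E.Nonempty)
    (hinj : ∀ x ∈ E, Function.Injective x) :
    Real.log E.card - Real.log k.factorial ≤ ∑ y, Real.binEntropy (pr E y) := by
  set p := pr E with hp
  set n : ℝ := (E.card : ℝ) with hn
  have hnpos : 0 < n := by rw [hn]; exact_mod_cast hE.card_pos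
  set Z : ℝ := (k.factorial : ℝ) with hZ
  have hZpos : 0 < Z := by rw [hZ]; exact_mod_cast Nat.factorial_pos k
  let w : (Fin k → Fin N) → ℝ := fun x => ∏ y, if (∃ i, x i = y) then p y else 1 - p y
  have hterm : ∀ x ∈ E, ∀ y, 0 < (if (∃ i, x i = y) then p y else 1 - p y) := by
    intro x hx y
    split_ifs with h
    · have h1 := card_mul_pr E hE y
      have h2 : 0 < (E.filter (fun x => ∃ i, x i = y)).card :=
        Finset.card_pos.2 ⟨x, Finset.mem_filter.2 ⟨hx, h⟩⟩
      have h3 : (0 : ℝ) < n * p y := by rw [h1]; exact_mod_cast h2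
      exact (pos_iff_pos_of_mul_pos h3).1 hnpos
    · have h1 := card_mul_one_sub_pr E hE y
      have h2 : 0 < (E.filter (fun x => ¬ ∃ i, x i = y)).card :=
        Finset.card_pos.2 ⟨x, Finset.mem_filter.2 ⟨hx, h⟩⟩
      have h3 : (0 : ℝ) < n * (1 - p y) := by rw [h1]; exact_mod_cast h2
      exact (pos_iff_pos_of_mul_pos h3).1 hnpos
  have hwpos : ∀ x ∈ E, 0 < w x := fun x hx => Finset.prod_pos (fun y _ => hterm x hx y)
  have hlogw : ∑ x ∈ E, Real.log (w x) = - (n * ∑ y, Real.binEntropy (p y)) := by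
    have h1 : ∀ x ∈ E, Real.log (w x) =
        ∑ y, if (∃ i, x i = y) then Real.log (p y) else Real.log (1 - p y) := by
      intro x hx
      rw [Real.log_prod (fun y _ => (hterm x hx y).ne')]
      apply Finset.sum_congr rfl
      intro y _
      split_ifs <;> rfl
    rw [Finset.sum_congr rfl h1, Finset.sum_comm, Finset.mul_sum, ← Finset.sum_neg_distrib]
    apply Finset.sum_congr rfl
    intro y _
    rw [Finset.sum_ite, Finset.sum_const, Finset.sum_const, nsmul_eq_mul, nsmul_eq_mul,
      ← card_mul_pr E hE, ← card_mul_one_sub_pr E hE]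
    unfold Real.binEntropy
    rw [Real.log_inv, Real.log_inv]
    ring
  have hsumw : ∑ x ∈ E, w x ≤ Z := by
    let g : Finset (Fin N) → ℝ := fun S => (∏ y ∈ S, p y) * ∏ y ∈ univ \ S, (1 - p y)
    have hg : ∀ S, 0 ≤ g S := fun S => mul_nonneg
      (Finset.prod_nonneg fun y _ => pr_nonneg E y)
      (Finset.prod_nonneg fun y _ => by have := pr_le_one E y; simp only [hp]; linarith)
    have hwg : ∀ x, w x = g (univ.image x) := by
      intro x
      simp only [w, g]
      rw [Finset.prod_ite]
      congr 1
      · apply Finset.prod_congr _ (fun _ _ => rfl)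
        ext y; simp
      · apply Finset.prod_congr _ (fun _ _ => rfl)
        ext y; simp
    calc ∑ x ∈ E, w x = ∑ S : Finset (Fin N), ∑ x ∈ E with univ.image x = S, w x := by
          rw [Finset.sum_fiberwise]
      _ ≤ ∑ S : Finset (Fin N), Z * g S := by
          apply Finset.sum_le_sum
          intro S _
          rw [Finset.sum_congr rfl (g := fun _ => g S)]
          · rw [Finset.sum_const, nsmul_eq_mul]
            apply mul_le_mul_of_nonneg_right _ (hg S)
            rw [hZ]
            exact_mod_cast fiber_card E hinj S
          · intro x hx
            rw [hwg x, (Finset.mem_filter.1 hx).2]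
      _ = Z * ∏ y, (p y + (1 - p y)) := by
          rw [← Finset.mul_sum, Finset.prod_add, Finset.powerset_univ]
      _ = Z := by simp
  have hG : ∑ x ∈ E, Real.log (w x * n / Z) ≤ 0 := by
    calc ∑ x ∈ E, Real.log (w x * n / Z) ≤ ∑ x ∈ E, (w x * n / Z - 1) := by
          apply Finset.sum_le_sum
          intro x hx
          have := hwpos x hx
          exact Real.log_le_sub_one_of_pos (by positivity)
      _ = (∑ x ∈ E, w x) * n / Z - n := by
          rw [Finset.sum_sub_distrib, ← Finset.sum_div, ← Finset.sum_mul]; simp [hn]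
      _ ≤ 0 := by
          rw [sub_nonpos, div_le_iff₀ hZpos]
          nlinarith
  have h2 : ∑ x ∈ E, Real.log (w x * n / Z) =
      ∑ x ∈ E, Real.log (w x) + n * (Real.log n - Real.log Z) := by
    rw [Finset.sum_congr rfl (g := fun x => Real.log (w x) + (Real.log n - Real.log Z))]
    · rw [Finset.sum_add_distrib, Finset.sum_const, nsmul_eq_mul]
    · intro x hx
      have := hwpos x hx
      rw [Real.log_div (by positivity) (by positivity), Real.log_mul (by positivity) (by positivity)]
      ring
  rw [h2, hlogw] at hG
  have : n * (Real.log n - Real.log Z) ≤ n * ∑ y, Real.binEntropy (p y) := by linarith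
  exact le_of_mul_le_mul_left this hnpos

lemma dsum (a p : ℝ) (ha : 0 < a) (ha1 : a < 1) (hp : 0 ≤ p) (hp1 : p ≤ 1) :
    a * klFun (p / a) + (1 - a) * klFun ((1 - p) / (1 - a)) =
      - Real.binEntropy p - p * Real.log a - (1 - p) * Real.log (1 - a) := by
  have hb : 0 < 1 - a := by linarith
  have key : ∀ c t : ℝ, 0 < c → 0 ≤ t → c * klFun (t / c) = t * Real.log t - t * Real.log c + c - t := by
    intro c t hc ht
    unfold klFun
    rcases ht.eq_or_lt with h | h
    · rw [← h]; simp
    · rw [Real.log_div h.ne' hc.ne']; field_simp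
  rw [key a p ha hp, key (1 - a) (1 - p) hb (by linarith)]
  unfold Real.binEntropy
  rw [Real.log_inv, Real.log_inv]
  ring

lemma injcard (k N : ℕ) :
    ((Finset.univ.filter (fun x : Fin k → Fin N => Function.Injective x)).card) =
      N.descFactorial k := by
  have := Fintype.card_embedding_eq (α := Fin k) (β := Fin N)
  simp only [Fintype.card_fin] at this
  rw [← this, ← Fintype.card_subtype]
  exact Fintype.card_congr (Equiv.subtypeInjectiveEquivEmbedding _ _)

/-- fibers -/
noncomputable def Ef {k N : ℕ} (f : (Fin k → Fin N) → List Bool) (m : List Bool) :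
    Finset (Fin k → Fin N) :=
  Finset.univ.filter (fun x => Function.Injective x ∧ f x = m)

noncomputable def Mf {k N : ℕ} (f : (Fin k → Fin N) → List Bool) : Finset (List Bool) :=
  (Finset.univ.filter (fun x : Fin k → Fin N => Function.Injective x)).image f

lemma Ef_nonempty {k N : ℕ} (f : (Fin k → Fin N) → List Bool) {m : List Bool} (hm : m ∈ Mf f) :
    (Ef f m).Nonempty := by
  unfold Mf at hm
  rw [Finset.mem_image] at hm
  obtain ⟨x, hx, rfl⟩ := hm
  exact ⟨x, by simpa [Ef] using hx⟩

lemma Ef_inj {k N : ℕ} (f : (Fin k → Fin N) → List Bool) (m : List Bool) :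
    ∀ x ∈ Ef f m, Function.Injective x := by
  intro x hx
  simp only [Ef, Finset.mem_filter] at hx
  exact hx.2.1

lemma sum_Ef {k N : ℕ} (f : (Fin k → Fin N) → List Bool) :
    ∑ m ∈ Mf f, ((Ef f m).card : ℝ) = N.descFactorial k := by
  rw [← injcard]
  rw [Finset.card_eq_sum_card_image f]
  push_cast
  apply Finset.sum_congr rfl
  intro m _
  congr 2
  ext x; simp [Ef]

lemma mi_bound {k N s : ℕ} (hk : 1 ≤ k) (hkN : k < N) (f : (Fin k → Fin N) → List Bool)
    (hM : (Mf f).card ≤ 2 ^ s) :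
    ∑ m ∈ Mf f, ((Ef f m).card : ℝ) / N.descFactorial k *
      ∑ z, ((k / N : ℝ) * klFun (pr (Ef f m) z / (k / N : ℝ)) +
        (1 - (k / N : ℝ)) * klFun ((1 - pr (Ef f m) z) / (1 - (k / N : ℝ)))) ≤
      s * Real.log 2 + Real.log (N + 1) := by
  set a : ℝ := (k / N : ℝ) with ha
  have hNr : (0 : ℝ) < N := by exact_mod_cast (by omega : 0 < N)
  have hkr : (0 : ℝ) < k := by exact_mod_cast hk
  have hkN' : (k : ℝ) < N := by exact_mod_cast hkN
  have ha0 : 0 < a := by positivity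
  have ha1 : a < 1 := by rw [ha, div_lt_one hNr]; exact hkN'
  have haN : a * N = k := by rw [ha]; field_simp
  set T : ℝ := (N.descFactorial k : ℝ) with hT
  have hTpos : 0 < T := by
    rw [hT]; exact_mod_cast Nat.descFactorial_pos.2 hkN.le
  set H : ℝ := - (k * Real.log a + (N - k) * Real.log (1 - a)) with hH
  have hin : ∀ m ∈ Mf f, ∑ z, (a * klFun (pr (Ef f m) z / a) +
        (1 - a) * klFun ((1 - pr (Ef f m) z) / (1 - a))) ≤
        H + Real.log k.factorial - Real.log (Ef f m).card := by
    intro m hm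
    rw [Finset.sum_congr rfl (fun z _ => dsum a _ ha0 ha1 (pr_nonneg _ z) (pr_le_one _ z))]
    have h1 := entropy (Ef f m) (Ef_nonempty f hm) (Ef_inj f m)
    have h2 := sum_pr (Ef f m) (Ef_nonempty f hm) (Ef_inj f m)
    rw [Finset.sum_sub_distrib, Finset.sum_sub_distrib, ← Finset.sum_mul, ← Finset.sum_mul,
      Finset.sum_neg_distrib, Finset.sum_sub_distrib, h2]
    simp only [Finset.sum_const, Finset.card_univ, Fintype.card_fin, nsmul_eq_mul, mul_one]
    rw [hH]
    linarith
  have hsum := sum_Ef f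
  rw [← hT] at hsum
  have hls := logsum (Mf f) (fun m => ((Ef f m).card : ℝ)) (fun _ => 1) (fun _ _ => by positivity)
    (fun _ _ => zero_le_one) (fun _ _ h => absurd h one_ne_zero)
  simp only [div_one, hsum, Finset.sum_const, nsmul_eq_mul, mul_one] at hls
  have hMpos : 0 < ((Mf f).card : ℝ) := by
    have : (Mf f).Nonempty := by
      by_contra h
      rw [Finset.not_nonempty_iff_eq_empty] at h
      rw [h] at hsum
      simp at hsum
      linarith
    exact_mod_cast this.card_pos
  have hlogM : Real.log (Mf f).card ≤ s * Real.log 2 := by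
    rw [← Real.log_pow]
    apply Real.log_le_log hMpos
    exact_mod_cast hM
  rw [Real.log_div hTpos.ne' hMpos.ne'] at hls
  have hmode := mode N k hkN.le (by omega)
  rw [← ha] at hmode
  have hchoose : (0 : ℝ) < N.choose k := by exact_mod_cast Nat.choose_pos hkN.le
  have hb : 0 < 1 - a := by linarith
  have hlm := Real.log_le_log one_pos hmode
  rw [Real.log_one, Real.log_mul (by positivity) (by positivity), Real.log_mul (by positivity) (by positivity),
    Real.log_mul (by positivity) (by positivity), Real.log_pow, Real.log_pow, Nat.cast_sub hkN.le] at hlm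
  have hTlog : Real.log T = Real.log k.factorial + Real.log (N.choose k) := by
    rw [hT, Nat.descFactorial_eq_factorial_mul_choose]
    push_cast
    rw [Real.log_mul (by positivity) (by positivity)]
  calc _ ≤ ∑ m ∈ Mf f, ((Ef f m).card : ℝ) / T * (H + Real.log k.factorial - Real.log (Ef f m).card) := by
        apply Finset.sum_le_sum
        intro m hm
        exact mul_le_mul_of_nonneg_left (hin m hm) (by positivity)
    _ = (H + Real.log k.factorial) - (∑ m ∈ Mf f, ((Ef f m).card : ℝ) * Real.log (Ef f m).card) / T := by
        simp_rw [mul_sub]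
        rw [Finset.sum_sub_distrib, ← Finset.sum_mul, ← Finset.sum_div, hsum, div_self hTpos.ne', one_mul,
          Finset.sum_div]
        congr 1
        apply Finset.sum_congr rfl
        intro m _; ring
    _ ≤ (H + Real.log k.factorial) - (Real.log T - Real.log (Mf f).card) := by
        have : Real.log T - Real.log (Mf f).card ≤
            (∑ m ∈ Mf f, ((Ef f m).card : ℝ) * Real.log (Ef f m).card) / T := by
          rw [le_div_iff₀ hTpos]; linarith
        linarith
    _ ≤ _ := by
        rw [hTlog, hH]; linarith

end SP

namespace SP
open InformationTheory (klFun klFun_nonneg klFun_one)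
open Finset

section chain
variable {N : ℕ} (A : ℕ → List Bool → Fin N → List Bool)

noncomputable def fk (k : ℕ) : (Fin k → Fin N) → List Bool := fun x => streamRun A x k

noncomputable def Fk (k : ℕ) : Finset (List Bool) := Finset.univ.image (fk A k)

lemma run_snoc_aux (k : ℕ) (y : Fin k → Fin N) (z : Fin N) (j : ℕ) (hj : j ≤ k) :
    streamRun A (Fin.snoc y z : Fin (k + 1) → Fin N) j = streamRun A y j := by
  induction j with
  | zero => rfl
  | succ j ih =>
    have h1 : j < k + 1 := by omega
    have h2 : j < k := by omega
    simp only [streamRun, h1, h2, dif_pos]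
    rw [ih (by omega)]
    congr 1
    have : (⟨j, h1⟩ : Fin (k + 1)) = Fin.castSucc ⟨j, h2⟩ := rfl
    rw [this, Fin.snoc_castSucc (α := fun _ => Fin N)]

lemma run_snoc (k : ℕ) (y : Fin k → Fin N) (z : Fin N) :
    fk A (k + 1) (Fin.snoc y z : Fin (k + 1) → Fin N) = A (k + 1) (fk A k y) z := by
  unfold fk
  have h1 : k < k + 1 := by omega
  simp only [streamRun, h1, dif_pos]
  rw [run_snoc_aux A k y z k le_rfl]
  congr 1
  have : (⟨k, h1⟩ : Fin (k + 1)) = Fin.last k := rfl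
  rw [this, Fin.snoc_last (α := fun _ => Fin N)]

lemma sum_snoc (k : ℕ) (G : (Fin (k + 1) → Fin N) → ℝ) :
    ∑ x, G x = ∑ y : Fin k → Fin N, ∑ z : Fin N, G (Fin.snoc y z : Fin (k + 1) → Fin N) := by
  rw [← Fintype.sum_equiv (Fin.snocEquiv (fun _ : Fin (k + 1) => Fin N))
    (fun w => G (Fin.snoc w.2 w.1 : Fin (k + 1) → Fin N)) G (fun w => rfl)]
  rw [Fintype.sum_prod_type, Finset.sum_comm]

lemma out_snoc (k : ℕ) (μ : (Fin (k + 1) → Fin N) → ℝ) (σ : List Bool) :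
    outDist A μ σ = ∑ w ∈ (Fk A k ×ˢ (univ : Finset (Fin N))) with A (k + 1) w.1 w.2 = σ,
      ∑ y : Fin k → Fin N, if fk A k y = w.1 then μ (Fin.snoc y w.2 : Fin (k + 1) → Fin N) else 0 := by
  unfold outDist
  rw [sum_snoc, Finset.sum_filter, Finset.sum_product]
  have h1 : ∀ y : Fin k → Fin N, ∀ z : Fin N,
      (if streamRun A (Fin.snoc y z : Fin (k + 1) → Fin N) (k + 1) = σ then
        μ (Fin.snoc y z : Fin (k + 1) → Fin N) else 0) =
      ∑ m ∈ Fk A k, if A (k + 1) m z = σ then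
        (if fk A k y = m then μ (Fin.snoc y z : Fin (k + 1) → Fin N) else 0) else 0 := by
    intro y z
    rw [Finset.sum_eq_single_of_mem (fk A k y) (by simp [Fk])]
    · have := run_snoc A k y z
      rw [fk] at this
      rw [this]; simp
    · intro m _ hm
      rw [if_neg (Ne.symm hm)]; simp
  simp_rw [h1]
  rw [Finset.sum_congr rfl (fun y _ => Finset.sum_comm)]
  rw [Finset.sum_comm]
  apply Finset.sum_congr rfl
  intro m _
  rw [Finset.sum_comm]
  apply Finset.sum_congr rfl
  intro z _
  split_ifs <;> simp

lemma out_zero (k : ℕ) (μ : (Fin k → Fin N) → ℝ) (σ : List Bool) (h : σ ∉ Fk A k) :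
    outDist A μ σ = 0 := by
  unfold outDist
  apply Finset.sum_eq_zero
  intro x _
  rw [if_neg]
  intro hx
  apply h
  rw [← hx]
  exact Finset.mem_image_of_mem (fk A k) (Finset.mem_univ x)

lemma kl_fin (k : ℕ) (μ ν : (Fin k → Fin N) → ℝ) :
    klDiv (outDist A μ) (outDist A ν) =
      ∑ σ ∈ Fk A k, outDist A μ σ * Real.log (outDist A μ σ / outDist A ν σ) := by
  unfold klDiv
  apply tsum_eq_sum
  intro σ hσ
  rw [out_zero A k μ σ hσ]; simp

lemma outP (k : ℕ) (m : List Bool) :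
    outDist A (Pdist N k) m = ((Ef (fk A k) m).card : ℝ) / N.descFactorial k := by
  unfold outDist Pdist Ef
  rw [Finset.card_filter]
  push_cast
  rw [Finset.sum_div]
  apply Finset.sum_congr rfl
  intro x _
  unfold fk
  by_cases h1 : streamRun A x k = m <;> by_cases h2 : Function.Injective x <;> simp [h1, h2]

lemma outQ_pos (hN : 0 < N) (k : ℕ) (m : List Bool) (hm : m ∈ Fk A k) :
    0 < outDist A (Qdist N k) m := by
  have hNr : (0 : ℝ) < N := by exact_mod_cast hN
  unfold outDist Qdist
  obtain ⟨x, _, hx⟩ := Finset.mem_image.1 hm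
  apply Finset.sum_pos'
  · intro i _; split_ifs <;> positivity
  · refine ⟨x, Finset.mem_univ _, ?_⟩
    rw [if_pos (show streamRun A x k = m from hx)]; positivity

lemma GQ (k : ℕ) (m : List Bool) (z : Fin N) :
    (∑ y : Fin k → Fin N, if fk A k y = m then
      Qdist N (k + 1) (Fin.snoc y z : Fin (k + 1) → Fin N) else 0) =
      outDist A (Qdist N k) m / N := by
  unfold outDist Qdist
  rw [Finset.sum_div]
  apply Finset.sum_congr rfl
  intro y _
  unfold fk
  split_ifs
  · rw [pow_succ, mul_inv]; rfl
  · simp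

lemma GP (k : ℕ) (hk : k < N) (m : List Bool) (z : Fin N) :
    (∑ y : Fin k → Fin N, if fk A k y = m then
      Pdist N (k + 1) (Fin.snoc y z : Fin (k + 1) → Fin N) else 0) =
      outDist A (Pdist N k) m * ((1 - pr (Ef (fk A k) m) z) / (N - k)) := by
  rw [outP]
  have hTpos : (0 : ℝ) < N.descFactorial k := by
    exact_mod_cast Nat.descFactorial_pos.2 hk.le
  have hNk : (0 : ℝ) < (N : ℝ) - k := by
    have : (k : ℝ) < N := by exact_mod_cast hk
    linarith
  have h1 : (∑ y : Fin k → Fin N, if fk A k y = m then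
      Pdist N (k + 1) (Fin.snoc y z : Fin (k + 1) → Fin N) else 0) =
      (((Ef (fk A k) m).filter (fun x => ¬ ∃ i, x i = z)).card : ℝ) *
        (((N : ℝ) - k) * N.descFactorial k)⁻¹ := by
    unfold Ef
    rw [Finset.filter_filter, Finset.card_filter]
    push_cast
    rw [Finset.sum_mul]
    apply Finset.sum_congr rfl
    intro y _
    unfold Pdist
    rw [Nat.descFactorial_succ]
    push_cast
    rw [Nat.cast_sub hk.le]
    have h3 : Function.Injective (Fin.snoc y z : Fin (k + 1) → Fin N) ↔
        Function.Injective y ∧ ¬ ∃ i, y i = z := by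
      rw [Fin.snoc_injective_iff]; simp
    by_cases h4 : fk A k y = m <;> by_cases h5 : Function.Injective y <;>
      by_cases h6 : ∃ i, y i = z <;> simp [h4, h5, h6, h3, mul_comm]
  rw [h1]
  rcases (Ef (fk A k) m).eq_empty_or_nonempty with h | h
  · simp [h]
  · rw [← card_mul_one_sub_pr _ h]
    field_simp

lemma chain (k : ℕ) (hk : k < N) :
    klDiv (outDist A (Pdist N (k + 1))) (outDist A (Qdist N (k + 1))) ≤
      klDiv (outDist A (Pdist N k)) (outDist A (Qdist N k)) +
      (1 / N : ℝ) * ∑ m ∈ Mf (fk A k), ((Ef (fk A k) m).card : ℝ) / N.descFactorial k *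
        ∑ z, klFun ((1 - pr (Ef (fk A k) m) z) / (1 - (k / N : ℝ))) := by
  have hNr : (0 : ℝ) < N := by exact_mod_cast (by omega : 0 < N)
  have hkN' : (k : ℝ) < N := by exact_mod_cast hk
  have hNk : (0 : ℝ) < (N : ℝ) - k := by linarith
  set P := outDist A (Pdist N k) with hP
  set Q := outDist A (Qdist N k) with hQ
  let r : List Bool → Fin N → ℝ := fun m z => (1 - pr (Ef (fk A k) m) z) / (N - k)
  have hr0 : ∀ m z, 0 ≤ r m z := fun m z => by
    have := pr_le_one (Ef (fk A k) m) z
    exact div_nonneg (by linarith) hNk.le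
  have hP0 : ∀ m, 0 ≤ P m := fun m => by rw [hP, outP]; positivity
  let gp : List Bool × Fin N → ℝ := fun w => P w.1 * r w.1 w.2
  let gq : List Bool × Fin N → ℝ := fun w => Q w.1 / N
  have hPs : ∀ σ, outDist A (Pdist N (k + 1)) σ =
      ∑ w ∈ (Fk A k ×ˢ (univ : Finset (Fin N))) with A (k + 1) w.1 w.2 = σ, gp w := by
    intro σ
    rw [out_snoc]
    exact Finset.sum_congr rfl (fun w _ => GP A k hk w.1 w.2)
  have hQs : ∀ σ, outDist A (Qdist N (k + 1)) σ =
      ∑ w ∈ (Fk A k ×ˢ (univ : Finset (Fin N))) with A (k + 1) w.1 w.2 = σ, gq w := by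
    intro σ
    rw [out_snoc]
    exact Finset.sum_congr rfl (fun w _ => GQ A k w.1 w.2)
  have hgq : ∀ w ∈ (Fk A k ×ˢ (univ : Finset (Fin N))), 0 < gq w := by
    intro w hw
    have := outQ_pos A (by omega) k w.1 (Finset.mem_product.1 hw).1
    exact div_pos this hNr
  rw [kl_fin, kl_fin]
  calc _ ≤ ∑ σ ∈ Fk A (k + 1), ∑ w ∈ (Fk A k ×ˢ (univ : Finset (Fin N))) with A (k + 1) w.1 w.2 = σ,
          gp w * Real.log (gp w / gq w) := by
        apply Finset.sum_le_sum
        intro σ _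
        rw [hPs, hQs]
        apply logsum
        · intro w _; exact mul_nonneg (hP0 _) (hr0 _ _)
        · intro w hw; exact (hgq w (Finset.mem_filter.1 hw).1).le
        · intro w hw h; exact absurd h (hgq w (Finset.mem_filter.1 hw).1).ne'
    _ = ∑ w ∈ Fk A k ×ˢ (univ : Finset (Fin N)), gp w * Real.log (gp w / gq w) := by
        apply Finset.sum_fiberwise_of_maps_to
        intro w hw
        obtain ⟨y, _, hy⟩ := Finset.mem_image.1 (Finset.mem_product.1 hw).1
        rw [← hy, ← run_snoc A k y w.2]
        exact Finset.mem_image_of_mem _ (Finset.mem_univ _)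
    _ = ∑ m ∈ Fk A k, (P m * Real.log (P m / Q m) + (1 / N : ℝ) * (P m *
          ∑ z, klFun ((1 - pr (Ef (fk A k) m) z) / (1 - (k / N : ℝ))))) := by
        rw [Finset.sum_product]
        apply Finset.sum_congr rfl
        intro m hm
        simp only [gp, gq]
        rcases (hP0 m).eq_or_lt with h | hPm
        · simp [← h]
        have hQm := outQ_pos A (by omega) k m hm
        rw [← hQ] at hQm
        have hne : (Ef (fk A k) m).Nonempty := by
          rw [Finset.nonempty_iff_ne_empty]
          intro he
          rw [hP, outP, he] at hPm
          simp at hPm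
        have hs := sum_pr _ hne (Ef_inj _ _)
        have hrs : ∑ z, r m z = 1 := by
          simp only [r]
          rw [← Finset.sum_div, Finset.sum_sub_distrib, hs]
          simp
          exact hNk.ne'
        have hz : ∀ z, klFun ((1 - pr (Ef (fk A k) m) z) / (1 - (k / N : ℝ))) =
            N * (r m z * Real.log (N * r m z)) + 1 - N * r m z := by
          intro z
          have : (1 - pr (Ef (fk A k) m) z) / (1 - (k / N : ℝ)) = N * r m z := by
            simp only [r]
            have : (1 - (k / N : ℝ)) = (N - k) / N := by field_simp
            rw [this]; field_simp
          rw [this]; unfold klFun; ring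
        simp_rw [hz]
        rw [Finset.sum_sub_distrib, Finset.sum_add_distrib, ← Finset.mul_sum, ← Finset.mul_sum, hrs]
        have hterm : ∀ z, P m * r m z * Real.log (P m * r m z / (Q m / N)) =
            P m * Real.log (P m / Q m) * r m z + P m * (r m z * Real.log (N * r m z)) := by
          intro z
          rcases (hr0 m z).eq_or_lt with h | h
          · rw [← h]; simp
          · have : P m * r m z / (Q m / N) = (P m / Q m) * (N * r m z) := by field_simp
            rw [this, Real.log_mul (by positivity) (by positivity)]
            ring
        simp_rw [hterm]
        rw [Finset.sum_add_distrib, ← Finset.mul_sum, ← Finset.mul_sum, hrs]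
        generalize ∑ x, r m x * Real.log (N * r m x) = W
        simp
        field_simp
    _ = _ := by
        rw [Finset.sum_add_distrib, ← Finset.mul_sum]
        congr 2
        symm
        have hsub : Mf (fk A k) ⊆ Fk A k := Finset.image_subset_image (Finset.filter_subset _ _)
        rw [← Finset.sum_subset hsub]
        · apply Finset.sum_congr rfl
          intro m _
          rw [hP, outP]
        · intro m _ hm
          have : Ef (fk A k) m = ∅ := by
            rw [← Finset.not_nonempty_iff_eq_empty]
            rintro ⟨x, hx⟩
            apply hm
            simp only [Ef, Finset.mem_filter] at hx
            unfold Mf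
            rw [Finset.mem_image]
            exact ⟨x, by simpa using hx.2.1, hx.2.2⟩
          rw [hP, outP, this]; simp

end chain

lemma mem_restrict {N k : ℕ} (hN : 0 < N) (A : ℕ → List Bool → Fin N → List Bool) (s : ℕ → ℕ)
    (h : MemoryBounded N (k + 1) A s) : MemoryBounded N k A s := by
  intro x i hi hik
  have := h (Fin.snoc x ⟨0, hN⟩ : Fin (k + 1) → Fin N) i hi (by omega)
  rwa [run_snoc_aux A k x _ i hik] at this

lemma Mf_card {N k : ℕ} (hk : 1 ≤ k) (A : ℕ → List Bool → Fin N → List Bool) (s : ℕ → ℕ)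
    (h : MemoryBounded N k A s) : (Mf (fk A k)).card ≤ 2 ^ (s k) := by
  have hsub : Mf (fk A k) ⊆ (univ : Finset (List.Vector Bool (s k))).image (fun v => v.1) := by
    intro m hm
    obtain ⟨x, _, rfl⟩ := Finset.mem_image.1 hm
    rw [Finset.mem_image]
    exact ⟨⟨fk A k x, h x k hk le_rfl⟩, Finset.mem_univ _, rfl⟩
  refine (Finset.card_le_card hsub).trans (Finset.card_image_le.trans ?_)
  rw [Finset.card_univ, card_vector]; simp

lemma kl_zero {N : ℕ} (A : ℕ → List Bool → Fin N → List Bool) :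
    klDiv (outDist A (Pdist N 0)) (outDist A (Qdist N 0)) = 0 := by
  rw [kl_fin]
  apply Finset.sum_eq_zero
  intro m hm
  have : Pdist N 0 = Qdist N 0 := by
    funext x
    simp [Pdist, Qdist, Function.injective_of_subsingleton]
  rw [this]
  by_cases h : outDist A (Qdist N 0) m = 0
  · simp [h]
  · simp [div_self h]

/-- step zero -/
lemma step_zero {N : ℕ} (hN : 0 < N) (A : ℕ → List Bool → Fin N → List Bool) :
    klDiv (outDist A (Pdist N 1)) (outDist A (Qdist N 1)) ≤ 0 := by
  refine (chain A 0 hN).trans ?_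
  rw [kl_zero]
  have : ∀ m, ∀ z, pr (Ef (fk A 0) m) z = 0 := by
    intro m z
    unfold pr; simp
  simp [this, klFun_one]

lemma step {N k : ℕ} (hk : 1 ≤ k) (hkN : k < N) (A : ℕ → List Bool → Fin N → List Bool) (s : ℕ → ℕ)
    (h : MemoryBounded N k A s) (L δ : ℝ) (hL : 0 < L) (hδ : 0 < δ) (hLa : L ≤ -Real.log (k / N : ℝ))
    (han : ∀ p : ℝ, 0 ≤ p → p ≤ 1 →
      (-Real.log (k / N : ℝ)) * klFun ((1 - p) / (1 - (k / N : ℝ))) ≤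
      (1 + δ) * ((k / N : ℝ) * klFun (p / (k / N : ℝ)) +
        (1 - (k / N : ℝ)) * klFun ((1 - p) / (1 - (k / N : ℝ))))) :
    klDiv (outDist A (Pdist N (k + 1))) (outDist A (Qdist N (k + 1))) ≤
      klDiv (outDist A (Pdist N k)) (outDist A (Qdist N k)) +
      (1 + δ) / (N * L) * (s k * Real.log 2 + Real.log (N + 1)) := by
  refine (chain A k hkN).trans ?_
  have hNr : (0 : ℝ) < N := by exact_mod_cast (by omega : 0 < N)
  have hkN' : (k : ℝ) < N := by exact_mod_cast hkN
  have hb : 0 < 1 - (k / N : ℝ) := by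
    have : (k / N : ℝ) < 1 := by rw [div_lt_one hNr]; exact hkN'
    linarith
  have hmi := mi_bound hk hkN (fk A k) (Mf_card hk A s h)
  set a : ℝ := (k / N : ℝ) with ha
  have hpt : ∀ p : ℝ, 0 ≤ p → p ≤ 1 → klFun ((1 - p) / (1 - a)) ≤
      (1 + δ) / L * (a * klFun (p / a) + (1 - a) * klFun ((1 - p) / (1 - a))) := by
    intro p hp hp1
    have h1 := han p hp hp1
    have hK : 0 ≤ klFun ((1 - p) / (1 - a)) := klFun_nonneg (div_nonneg (by linarith) hb.le)
    rw [div_mul_eq_mul_div, le_div_iff₀ hL]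
    nlinarith
  have : ∑ m ∈ Mf (fk A k), ((Ef (fk A k) m).card : ℝ) / N.descFactorial k *
        ∑ z, klFun ((1 - pr (Ef (fk A k) m) z) / (1 - a)) ≤
      (1 + δ) / L * (s k * Real.log 2 + Real.log (N + 1)) := by
    refine le_trans ?_ (mul_le_mul_of_nonneg_left hmi (by positivity))
    rw [Finset.mul_sum]
    apply Finset.sum_le_sum
    intro m _
    rw [mul_left_comm]
    apply mul_le_mul_of_nonneg_left _ (by positivity)
    rw [Finset.mul_sum]
    apply Finset.sum_le_sum
    intro z _
    exact hpt _ (pr_nonneg _ _) (pr_le_one _ _)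
  have h2 : (1 + δ) / (N * L) * (s k * Real.log 2 + Real.log (N + 1)) =
      (1 / N : ℝ) * ((1 + δ) / L * (s k * Real.log 2 + Real.log (N + 1))) := by
    field_simp
  rw [h2]
  gcongr

end SP

/-- For every constant `ε > 0` and every `δ > 0` there exists `N₀` such that for all
`N ≥ N₀`, all `q ≤ N^(1-ε)`, all nonnegative integers `s_1, …, s_q`
(satisfying `s_1 ≤ ⌈log₂ N⌉` and `s_{i+1} ≤ s_i + ⌈log₂ N⌉`), and every
`(s_1, …, s_q)`-memory-bounded streaming algorithm `A`:
`D_KL(P_A ‖ Q_A) ≤ (1+δ)·(Σ_{i=1}^{q-1} s_i + q log₂ N) / (ε N log₂ N)`. -/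
theorem stmt_1 :
    ∀ ε > (0 : ℝ), ∀ δ > (0 : ℝ), ∃ N₀ : ℕ, ∀ N : ℕ, N₀ ≤ N →
      ∀ q : ℕ, (q : ℝ) ≤ (N : ℝ) ^ ((1 : ℝ) - ε) →
        ∀ s : ℕ → ℕ,
          s 1 ≤ Nat.clog 2 N →
          (∀ i : ℕ, 1 ≤ i → i + 1 ≤ q → s (i + 1) ≤ s i + Nat.clog 2 N) →
          ∀ A : ℕ → List Bool → Fin N → List Bool, MemoryBounded N q A s →
            klDiv (outDist A (Pdist N q)) (outDist A (Qdist N q)) ≤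
              (1 + δ) *
                (((∑ i ∈ Finset.Icc 1 (q - 1), (s i : ℝ)) + q * Real.logb 2 N) /
                  (ε * N * Real.logb 2 N)) := by
  intro ε hε δ hδ
  set η := min δ 1 / 3 with hη
  have hηpos : 0 < η := by positivity
  have hη2 : (1 + η) * (1 + η) ≤ 1 + δ := by
    have h1 : 3 * η ≤ δ := by rw [hη]; linarith [min_le_left δ 1]
    have h2 : 3 * η ≤ 1 := by rw [hη]; linarith [min_le_right δ 1]
    nlinarith
  obtain ⟨L0, hL0, han⟩ := SP.analytic η hηpos
  have hlog : Filter.Tendsto (fun N : ℕ => Real.log (N : ℝ)) Filter.atTop Filter.atTop :=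
    Real.tendsto_log_atTop.comp tendsto_natCast_atTop_atTop
  have hev := (hlog.eventually_ge_atTop (L0 / ε)).and (hlog.eventually_ge_atTop (Real.log 2 / η))
  obtain ⟨N1, hN1⟩ := Filter.eventually_atTop.1 hev
  refine ⟨max N1 2, ?_⟩
  intro N hN q hq s _ _ A hA
  have hN2 : 2 ≤ N := le_trans (le_max_right _ _) hN
  obtain ⟨hlN1, hlN2⟩ := hN1 N (le_trans (le_max_left _ _) hN)
  have hNr : (2 : ℝ) ≤ N := by exact_mod_cast hN2
  have hNpos : (0 : ℝ) < N := by linarith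
  have hlogN : 0 < Real.log N := Real.log_pos (by linarith)
  have hlog2 : 0 < Real.log 2 := Real.log_pos (by norm_num)
  set L := ε * Real.log N with hL
  have hLpos : 0 < L := by positivity
  have hL0L : L0 ≤ L := by rw [div_le_iff₀ hε] at hlN1; linarith
  have hlogN1 : Real.log (N + 1) ≤ (1 + η) * Real.log N := by
    have h1 : Real.log ((N : ℝ) + 1) ≤ Real.log (2 * N) := Real.log_le_log (by positivity) (by linarith)
    rw [Real.log_mul (by norm_num) hNpos.ne'] at h1
    rw [div_le_iff₀ hηpos] at hlN2
    linarith
  have hlogb : Real.logb 2 N = Real.log N / Real.log 2 := rfl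
  -- induction
  have main : ∀ k : ℕ, (k : ℝ) + 1 ≤ (N : ℝ) ^ ((1 : ℝ) - ε) → MemoryBounded N (k + 1) A s →
      klDiv (outDist A (Pdist N (k + 1))) (outDist A (Qdist N (k + 1))) ≤
        (1 + η) / (N * L) * (∑ i ∈ Finset.Icc 1 k, (s i * Real.log 2 + Real.log (N + 1))) := by
    intro k
    induction k with
    | zero =>
      intro _ _
      simpa using SP.step_zero (by omega) A
    | succ k ih =>
      intro hk hm
      have hm' := SP.mem_restrict (by omega) A s hm
      push_cast at hk
      have hi := ih (by linarith) hm'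
      rw [Finset.sum_Icc_succ_top (by omega), mul_add]
      have hk1 : (0 : ℝ) < ((k + 1 : ℕ) : ℝ) := by positivity
      have hkle : ((k + 1 : ℕ) : ℝ) ≤ (N : ℝ) ^ ((1 : ℝ) - ε) := by push_cast; linarith
      have hlk : Real.log ((k + 1 : ℕ) : ℝ) ≤ (1 - ε) * Real.log N := by
        rw [← Real.log_rpow hNpos]
        exact Real.log_le_log hk1 hkle
      have hLa : L ≤ -Real.log (((k + 1 : ℕ) : ℝ) / N) := by
        rw [Real.log_div hk1.ne' hNpos.ne', hL]; linarith
      have hkN : k + 1 < N := by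
        have : Real.log ((k + 1 : ℕ) : ℝ) < Real.log N := by linarith
        have := (Real.log_lt_log_iff hk1 hNpos).1 this
        exact_mod_cast this
      have hst := SP.step (by omega) hkN A s hm' L η hLpos hηpos hLa
        (han _ (by positivity) (hL0L.trans hLa))
      linarith
  have hlb : 0 < Real.logb 2 N := by rw [hlogb]; positivity
  rcases q with _ | k
  · rw [SP.kl_zero]; positivity
  have h1 := main k (by exact_mod_cast hq) hA
  refine h1.trans ?_
  rw [Nat.add_sub_cancel, Finset.sum_add_distrib, ← Finset.sum_mul]
  simp only [Finset.sum_const, Nat.card_Icc, Nat.add_sub_cancel, nsmul_eq_mul]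
  set S : ℝ := ∑ i ∈ Finset.Icc 1 k, (s i : ℝ) with hS
  have hS0 : 0 ≤ S := Finset.sum_nonneg (fun _ _ => by positivity)
  have e : (1 + δ) * ((S + ((k + 1 : ℕ) : ℝ) * Real.logb 2 N) / (ε * N * Real.logb 2 N)) =
      1 / (N * L) * ((1 + δ) * (S * Real.log 2 + ((k + 1 : ℕ) : ℝ) * Real.log N)) := by
    rw [hlogb, hL]; field_simp
  rw [e]
  have e2 : (1 + η) / (N * L) * (S * Real.log 2 + k * Real.log (N + 1)) =
      1 / (N * L) * ((1 + η) * (S * Real.log 2 + k * Real.log (N + 1))) := by ring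
  rw [e2]
  apply mul_le_mul_of_nonneg_left _ (by positivity)
  have hx : S * Real.log 2 + k * Real.log (N + 1) ≤
      (1 + η) * (S * Real.log 2 + ((k + 1 : ℕ) : ℝ) * Real.log N) := by
    push_cast
    have h3 : (k : ℝ) * Real.log (N + 1) ≤ k * ((1 + η) * Real.log N) := by gcongr
    have h4 : 0 ≤ S * Real.log 2 := by positivity
    nlinarith
  calc _ ≤ (1 + η) * ((1 + η) * (S * Real.log 2 + ((k + 1 : ℕ) : ℝ) * Real.log N)) := by gcongr
    _ = ((1 + η) * (1 + η)) * (S * Real.log 2 + ((k + 1 : ℕ) : ℝ) * Real.log N) := by ring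
    _ ≤ _ := by gcongr
end

section
/- The function p(x) = (log(1−x) + 1)/(log(1−x) − log x) is strictly increasing on the open interval (0, 1/2); indeed its derivative satisfies p′(x) = (1 − h₂(x)) / ( x(1−x)(log(1−x) − log x)² ) > 0 for all x ∈ (0, 1/2), where h₂(x) = −x log x − (1−x) log(1−x). -/
/-- The binary entropy function (natural logarithm). -/
noncomputable def binEnt (x : ℝ) : ℝ := -(x * Real.log x) - (1 - x) * Real.log (1 - x)

/-- The function `p(x) = (log(1-x) + 1)/(log(1-x) - log x)`. -/
noncomputable def pFun (x : ℝ) : ℝ :=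
  (Real.log (1 - x) + 1) / (Real.log (1 - x) - Real.log x)

theorem pFun_aux (x : ℝ) (hx : x ∈ Set.Ioo (0 : ℝ) (1 / 2)) :
    HasDerivAt pFun
      ((1 - binEnt x) / (x * (1 - x) * (Real.log (1 - x) - Real.log x) ^ 2)) x ∧
    0 < (1 - binEnt x) / (x * (1 - x) * (Real.log (1 - x) - Real.log x) ^ 2) := by
  obtain ⟨h0, h1⟩ := hx
  have h2 : 0 < 1 - x := by linarith
  have hlog : 0 < Real.log (1 - x) - Real.log x :=
    sub_pos.2 (Real.log_lt_log h0 (by linarith))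
  constructor
  · have hL : HasDerivAt (fun y : ℝ => Real.log (1 - y)) (-1 / (1 - x)) x :=
      ((hasDerivAt_id x).const_sub 1).log h2.ne'
    have hM := Real.hasDerivAt_log h0.ne'
    have h := (hL.add_const 1).div (hL.sub hM) hlog.ne'
    refine HasDerivAt.congr_deriv (f := pFun) h ?_
    simp only [Pi.sub_apply, binEnt]
    have := hlog.ne'
    have := h2.ne'
    have := h0.ne'
    field_simp
    ring
  · have hb : binEnt x < 1 := by
      have e : binEnt x = Real.binEntropy x := by
        simp only [binEnt, Real.binEntropy, Real.log_inv]
        ring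
      have := Real.binEntropy_le_log_two (p := x)
      have := Real.log_two_lt_d9
      linarith
    have : 0 < 1 - binEnt x := by linarith
    positivity

/-- `p` is strictly increasing on `(0, 1/2)`; indeed its derivative satisfies
`p′(x) = (1 - h₂(x)) / (x (1-x) (log(1-x) - log x)²) > 0` for all `x ∈ (0, 1/2)`. -/
theorem stmt_16 :
    StrictMonoOn pFun (Set.Ioo (0 : ℝ) (1 / 2)) ∧
      ∀ x ∈ Set.Ioo (0 : ℝ) (1 / 2),
        deriv pFun x =
            (1 - binEnt x) / (x * (1 - x) * (Real.log (1 - x) - Real.log x) ^ 2) ∧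
          0 < (1 - binEnt x) / (x * (1 - x) * (Real.log (1 - x) - Real.log x) ^ 2) := by
  refine ⟨?_, fun x hx => ⟨(pFun_aux x hx).1.deriv, (pFun_aux x hx).2⟩⟩
  apply strictMonoOn_of_deriv_pos (convex_Ioo _ _)
  · intro x hx
    exact (pFun_aux x hx).1.continuousAt.continuousWithinAt
  · intro x hx
    rw [interior_Ioo] at hx
    rw [(pFun_aux x hx).1.deriv]
    exact (pFun_aux x hx).2
end
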